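/- Let p ≥ 1 be an integer, m > 0 an irrational real number, and k0 ≥ 3 an integer. Then there exist constants M > 0, c > 0 and C > 0 (depending only on p, m, k0) such that for every ρ ∈ (0, M) there exist real numbers α and ω with α ≥ c·ρ^(2p) and |ω² − (1+m)| ≤ C·ρ^(2p+1), and a function u : ℝ × ℝ → ℝ of class C^{k0} such that: (i) for all (t,x), ∂_t² u(t,x) − ∂_x² u(t,x) − α·∂_t ∂_x² u(t,x) + m·u(t,x) = (∂_t u(t,x))^(2p+1); (ii) u(t,0) = u(t,π) = 0 for all t; (iii) u(t + 2π/ω, x) = u(t,x) for all (t,x); (iv) there is a function v : ℝ × ℝ → ℝ, 2π-periodic in its first argument, with u(t,x) = ρ·cos(ωt)·sin(x) + v(ωt, x) for all (t,x) and sup_{(t,x)} |v(t,x)| ≤ C·ρ^(2p+1/2). -/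

import Mathlib

/-- Partial derivative in the first variable. -/
noncomputable def pdt (u : ℝ → ℝ → ℝ) (t x : ℝ) : ℝ := deriv (fun s => u s x) t

/-- Second partial derivative in the first variable. -/
noncomputable def pdtt (u : ℝ → ℝ → ℝ) (t x : ℝ) : ℝ := deriv (fun s => pdt u s x) t

/-- Second partial derivative in the second variable. -/
noncomputable def pdxx (u : ℝ → ℝ → ℝ) (t x : ℝ) : ℝ :=
  deriv (fun y => deriv (fun z => u t z) y) x

/-- Mixed partial derivative ∂ₜ∂ₓ². -/
noncomputable def pdtxx (u : ℝ → ℝ → ℝ) (t x : ℝ) : ℝ := deriv (fun s => pdxx u s x) t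

namespace SDB

noncomputable abbrev A := lp (fun _ : ℤ × ℤ => ℂ) 1

lemma A_summable (f : A) : Summable (fun n => ‖f n‖) := by
  have h := (memℓp_gen_iff (p := 1) (by simp)).1 f.2
  simpa using h

lemma A_norm (f : A) : ‖f‖ = ∑' n, ‖f n‖ := by
  rw [lp.norm_eq_tsum_rpow (by simp)]
  simp

def mk (f : ℤ × ℤ → ℂ) (h : Summable (fun n => ‖f n‖)) : A :=
  ⟨f, (memℓp_gen_iff (p := 1) (by simp)).2 (by simpa using h)⟩

@[simp] lemma mk_apply (f : ℤ × ℤ → ℂ) (h : Summable (fun n => ‖f n‖)) (n : ℤ × ℤ) :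
    mk f h n = f n := rfl

lemma A_coef (f : A) (n : ℤ × ℤ) : ‖f n‖ ≤ ‖f‖ := lp.norm_apply_le_norm (by simp) f n

lemma A_ext {f g : A} (h : ∀ n, f n = g n) : f = g := lp.ext (funext h)

lemma A_norm_le (f : A) (g : ℤ × ℤ → ℝ) (hg : Summable g) (h : ∀ n, ‖f n‖ ≤ g n) :
    ‖f‖ ≤ ∑' n, g n := by
  rw [A_norm]
  exact (A_summable f).tsum_le_tsum h hg

@[simp] lemma sub_apply (f g : A) (n : ℤ × ℤ) : (f - g) n = f n - g n := rfl
@[simp] lemma add_apply (f g : A) (n : ℤ × ℤ) : (f + g) n = f n + g n := rfl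
@[simp] lemma neg_apply (f : A) (n : ℤ × ℤ) : (-f) n = - f n := rfl
@[simp] lemma zero_apply (n : ℤ × ℤ) : (0 : A) n = 0 := rfl

/-- weights -/
noncomputable def wt (s : ℕ) (n : ℤ × ℤ) : ℝ := ((1 + |(n.1 : ℝ)|) * (1 + |(n.2 : ℝ)|)) ^ s

lemma wt_one_le (s : ℕ) (n : ℤ × ℤ) : 1 ≤ wt s n := by
  unfold wt
  apply one_le_pow₀
  nlinarith [abs_nonneg (n.1 : ℝ), abs_nonneg (n.2 : ℝ),
    mul_nonneg (abs_nonneg (n.1 : ℝ)) (abs_nonneg (n.2 : ℝ))]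

lemma wt_pos (s : ℕ) (n : ℤ × ℤ) : 0 < wt s n := lt_of_lt_of_le one_pos (wt_one_le s n)

lemma wt_add (s : ℕ) (k l : ℤ × ℤ) : wt s (k + l) ≤ wt s k * wt s l := by
  unfold wt
  rw [← mul_pow]
  have key : ∀ a b : ℝ, 1 + |a + b| ≤ (1 + |a|) * (1 + |b|) := by
    intro a b
    nlinarith [abs_add_le a b, mul_nonneg (abs_nonneg a) (abs_nonneg b)]
  apply pow_le_pow_left₀ (by positivity)
  have h1 := key k.1 l.1
  have h2 := key k.2 l.2
  simp only [Prod.fst_add, Prod.snd_add, Int.cast_add]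
  calc _ ≤ ((1 + |(k.1:ℝ)|) * (1 + |(l.1:ℝ)|)) * ((1 + |(k.2:ℝ)|) * (1 + |(l.2:ℝ)|)) := by
        apply mul_le_mul h1 h2 (by positivity) (by positivity)
    _ = _ := by ring

/-- kernel -/
noncomputable def ka (s : ℕ) (k l : ℤ × ℤ) : ℝ := wt s (k + l) / (wt s k * wt s l)

lemma ka_pos (s : ℕ) (k l : ℤ × ℤ) : 0 < ka s k l :=
  div_pos (wt_pos _ _) (mul_pos (wt_pos _ _) (wt_pos _ _))

lemma ka_le (s : ℕ) (k l : ℤ × ℤ) : ka s k l ≤ 1 :=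
  (div_le_one (mul_pos (wt_pos _ _) (wt_pos _ _))).2 (wt_add s k l)

lemma wt_neg (s : ℕ) (n : ℤ × ℤ) : wt s (-n) = wt s n := by simp [wt]

def rf (n : ℤ × ℤ) : ℤ × ℤ := (n.1, -n.2)

lemma wt_rf (s : ℕ) (n : ℤ × ℤ) : wt s (rf n) = wt s n := by simp [wt, rf]

lemma rf_add (k l : ℤ × ℤ) : rf (k + l) = rf k + rf l := by
  ext <;> simp [rf]; ring

lemma rf_sub (k l : ℤ × ℤ) : rf (k - l) = rf k - rf l := by
  ext <;> simp [rf]; ring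

lemma rf_rf (k : ℤ × ℤ) : rf (rf k) = k := by
  ext <;> simp [rf]

lemma ka_neg (s : ℕ) (k l : ℤ × ℤ) : ka s (-k) (-l) = ka s k l := by
  unfold ka; rw [← neg_add, wt_neg, wt_neg, wt_neg]

lemma ka_rf (s : ℕ) (k l : ℤ × ℤ) : ka s (rf k) (rf l) = ka s k l := by
  unfold ka; rw [← rf_add, wt_rf, wt_rf, wt_rf]

def eqv : (ℤ × ℤ) × (ℤ × ℤ) ≃ (ℤ × ℤ) × (ℤ × ℤ) where
  toFun q := (q.2, q.1 - q.2)
  invFun q := (q.1 + q.2, q.1)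
  left_inv q := by simp
  right_inv q := by simp

noncomputable def cterm (s : ℕ) (f g : ℤ × ℤ → ℂ) (q : (ℤ × ℤ) × (ℤ × ℤ)) : ℂ :=
  ((ka s q.1 q.2 : ℝ) : ℂ) * (f q.1 * g q.2)

lemma cterm_norm_le (s : ℕ) (f g : ℤ × ℤ → ℂ) (q : (ℤ × ℤ) × (ℤ × ℤ)) :
    ‖cterm s f g q‖ ≤ ‖f q.1‖ * ‖g q.2‖ := by
  unfold cterm
  rw [norm_mul, norm_mul, Complex.norm_real, Real.norm_of_nonneg (ka_pos _ _ _).le]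
  exact mul_le_of_le_one_left (by positivity) (ka_le _ _ _)

lemma summable_ff (f g : A) : Summable (fun q : (ℤ × ℤ) × (ℤ × ℤ) => ‖f q.1‖ * ‖g q.2‖) := by
  have := (A_summable f).mul_norm (A_summable g)
  simpa using this

lemma cterm_summable (s : ℕ) (f g : A) : Summable (fun q => ‖cterm s f g q‖) :=
  Summable.of_nonneg_of_le (fun _ => norm_nonneg _) (cterm_norm_le s f g) (summable_ff f g)

lemma cterm_summable' (s : ℕ) (f g : A) : Summable (fun q => ‖cterm s f g (eqv q)‖) :=
  (Equiv.summable_iff eqv).2 (cterm_summable s f g)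

noncomputable def convf (s : ℕ) (f g : ℤ × ℤ → ℂ) (n : ℤ × ℤ) : ℂ :=
  ∑' k, cterm s f g (k, n - k)

lemma conv_term_summable (s : ℕ) (f g : A) (n : ℤ × ℤ) :
    Summable (fun k => ‖cterm s f g (k, n - k)‖) :=
  (cterm_summable' s f g).prod_factor n

lemma convf_norm_le (s : ℕ) (f g : A) (n : ℤ × ℤ) :
    ‖convf s f g n‖ ≤ ∑' k, ‖cterm s f g (eqv (n, k))‖ :=
  norm_tsum_le_tsum_norm (conv_term_summable s f g n)

lemma convf_summable (s : ℕ) (f g : A) : Summable (fun n => ‖convf s f g n‖) :=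
  Summable.of_nonneg_of_le (fun _ => norm_nonneg _) (convf_norm_le s f g)
    ((cterm_summable' s f g).prod)

noncomputable def cv (s : ℕ) (f g : A) : A := mk (convf s f g) (convf_summable s f g)

lemma cv_apply (s : ℕ) (f g : A) (n : ℤ × ℤ) :
    cv s f g n = ∑' k, ((ka s k (n - k) : ℝ) : ℂ) * (f k * g (n - k)) := rfl

lemma cv_norm (s : ℕ) (f g : A) : ‖cv s f g‖ ≤ ‖f‖ * ‖g‖ := by
  have h1 := A_norm_le (cv s f g) _ ((cterm_summable' s f g).prod) (convf_norm_le s f g)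
  refine h1.trans ?_
  rw [← (cterm_summable' s f g).tsum_prod]
  rw [Equiv.tsum_eq eqv (fun q => ‖cterm s f g q‖)]
  rw [A_norm, A_norm, tsum_mul_tsum_of_summable_norm (by simpa using A_summable f)
    (by simpa using A_summable g)]
  exact (cterm_summable s f g).tsum_le_tsum (cterm_norm_le s f g) (summable_ff f g)

lemma cv_sub_left (s : ℕ) (f f' g : A) : cv s (f - f') g = cv s f g - cv s f' g := by
  apply A_ext
  intro n
  rw [sub_apply]
  refine Eq.trans ?_ ((conv_term_summable s f g n).of_norm.tsum_sub
    (conv_term_summable s f' g n).of_norm)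
  rw [cv_apply]
  congr 1; ext k
  simp only [sub_apply, cterm]; ring

lemma cv_sub_right (s : ℕ) (f g g' : A) : cv s f (g - g') = cv s f g - cv s f g' := by
  apply A_ext
  intro n
  rw [sub_apply]
  refine Eq.trans ?_ ((conv_term_summable s f g n).of_norm.tsum_sub
    (conv_term_summable s f g' n).of_norm)
  rw [cv_apply]
  congr 1; ext k
  simp only [sub_apply, cterm]; ring

/-- `pw s f n` is the `(n+1)`st power. -/
noncomputable def pw (s : ℕ) (f : A) : ℕ → A
  | 0 => f
  | n + 1 => cv s f (pw s f n)

lemma pw_norm (s : ℕ) (f : A) (n : ℕ) : ‖pw s f n‖ ≤ ‖f‖ ^ (n + 1) := by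
  induction n with
  | zero => simp [pw]
  | succ n ih =>
    calc _ ≤ ‖f‖ * ‖pw s f n‖ := cv_norm _ _ _
      _ ≤ ‖f‖ * ‖f‖ ^ (n + 1) := by gcongr
      _ = _ := by ring

lemma pw_lip (s : ℕ) (R : ℝ) (hR : 0 ≤ R) (n : ℕ) : ∃ Λ : ℝ, 0 ≤ Λ ∧ ∀ f g : A, ‖f‖ ≤ R → ‖g‖ ≤ R →
    ‖pw s f n - pw s g n‖ ≤ Λ * ‖f - g‖ := by
  induction n with
  | zero => exact ⟨1, by simp, fun f g _ _ => by simp [pw]⟩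
  | succ n ih =>
    obtain ⟨Λ, h0, h⟩ := ih
    refine ⟨R * Λ + R ^ (n + 1), by positivity, fun f g hf hg => ?_⟩
    have e : pw s f (n+1) - pw s g (n+1)
        = cv s f (pw s f n - pw s g n) + cv s (f - g) (pw s g n) := by
      rw [cv_sub_left, cv_sub_right]; simp [pw]
    rw [e]
    calc _ ≤ ‖cv s f (pw s f n - pw s g n)‖ + ‖cv s (f - g) (pw s g n)‖ := norm_add_le _ _
      _ ≤ ‖f‖ * ‖pw s f n - pw s g n‖ + ‖f - g‖ * ‖pw s g n‖ := by
        gcongr <;> exact cv_norm _ _ _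
      _ ≤ R * (Λ * ‖f - g‖) + ‖f - g‖ * R ^ (n + 1) := by
        gcongr
        · exact h f g hf hg
        · exact (pw_norm s g n).trans (by gcongr)
      _ = _ := by ring

/-! symmetries -/
def IsReal (f : A) : Prop := ∀ n, f (-n) = starRingEnd ℂ (f n)
def IsOdd (f : A) : Prop := ∀ n, f (rf n) = - f n

def rfE : ℤ × ℤ ≃ ℤ × ℤ := ⟨rf, rf, rf_rf, rf_rf⟩

lemma cv_real (s : ℕ) {f g : A} (hf : IsReal f) (hg : IsReal g) : IsReal (cv s f g) := by
  intro n
  rw [cv_apply, cv_apply, Complex.conj_tsum, ← Equiv.tsum_eq (Equiv.neg (ℤ × ℤ))]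
  congr 1; ext k
  simp only [Equiv.neg_apply, map_mul, Complex.conj_ofReal]
  have : -n - -k = -(n - k) := by abel
  rw [this, ka_neg, hf, hg]

lemma cv_rf (s : ℕ) {f g : A} (n : ℤ × ℤ) : cv s f g (rf n) =
    ∑' k, ((ka s k (n - k) : ℝ) : ℂ) * (f (rf k) * g (rf (n - k))) := by
  rw [cv_apply, ← Equiv.tsum_eq rfE]
  congr 1; ext k
  have : rfE k = rf k := rfl
  rw [this, ← rf_sub, ka_rf]

lemma pw_real (s : ℕ) {f : A} (hf : IsReal f) (n : ℕ) : IsReal (pw s f n) := by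
  induction n with
  | zero => exact hf
  | succ n ih => exact cv_real s hf ih

lemma pw_odd_aux (s : ℕ) {f : A} (hf : IsOdd f) (n : ℕ) :
    ∀ k, pw s f n (rf k) = (-1) ^ (n + 1) * pw s f n k := by
  induction n with
  | zero => intro k; simp [pw, hf k]
  | succ n ih =>
    intro k
    change cv s f (pw s f n) (rf k) = _ * cv s f (pw s f n) k
    rw [cv_rf, cv_apply, ← tsum_mul_left]
    congr 1; ext l
    rw [hf, ih]; ring

lemma pw_odd (s : ℕ) {f : A} (hf : IsOdd f) (p : ℕ) : IsOdd (pw s f (2 * p)) := by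
  intro k
  rw [pw_odd_aux s hf, pow_succ, pow_mul]; simp

/-! support in the second index -/
lemma pw_supp (s : ℕ) {f : A} (hf : ∀ n : ℤ × ℤ, 1 < |n.2| → f n = 0) (m : ℕ) :
    ∀ n : ℤ × ℤ, (m + 1 : ℤ) < |n.2| → pw s f m n = 0 := by
  induction m with
  | zero => intro n hn; exact hf n (by simpa using hn)
  | succ m ih =>
    intro n hn
    change cv s f (pw s f m) n = 0
    rw [cv_apply]
    convert tsum_zero with k
    by_cases hk : 1 < |k.2|
    · rw [hf k hk]; simp
    · rw [ih (n - k)]; · simp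
      have := abs_sub_abs_le_abs_sub n.2 k.2
      push_cast at hn
      simp only [Prod.snd_sub]
      omega

/-! multipliers -/
open Classical in
noncomputable def mult (μ : ℤ × ℤ → ℂ) (f : A) : A :=
  if h : Summable (fun n => ‖μ n * f n‖) then mk (fun n => μ n * f n) h else 0

lemma mult_summable {μ : ℤ × ℤ → ℂ} {C : ℝ} (f : A) (h : ∀ n, ‖μ n * f n‖ ≤ C * ‖f n‖) :
    Summable (fun n => ‖μ n * f n‖) :=
  Summable.of_nonneg_of_le (fun _ => norm_nonneg _) h ((A_summable f).mul_left C)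

lemma mult_apply {μ : ℤ × ℤ → ℂ} {C : ℝ} {f : A} (h : ∀ n, ‖μ n * f n‖ ≤ C * ‖f n‖) (n : ℤ × ℤ) :
    mult μ f n = μ n * f n := by
  unfold mult; rw [dif_pos (mult_summable f h)]; rfl

lemma mult_norm {μ : ℤ × ℤ → ℂ} {C : ℝ} {f : A} (h : ∀ n, ‖μ n * f n‖ ≤ C * ‖f n‖) :
    ‖mult μ f‖ ≤ C * ‖f‖ := by
  rw [A_norm f, ← tsum_mul_left]
  apply A_norm_le _ _ ((A_summable f).mul_left C)
  intro n; rw [mult_apply h]; exact h n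

end SDB

namespace SDB

noncomputable def ee (n : ℤ × ℤ) (t x : ℝ) : ℂ :=
  Complex.exp (Complex.I * ((n.1 : ℝ) * t + (n.2 : ℝ) * x : ℝ))

lemma ee_norm (n : ℤ × ℤ) (t x : ℝ) : ‖ee n t x‖ = 1 := by
  unfold ee; rw [mul_comm]; exact Complex.norm_exp_ofReal_mul_I _

lemma ee_add (k l : ℤ × ℤ) (t x : ℝ) : ee (k + l) t x = ee k t x * ee l t x := by
  unfold ee; rw [← Complex.exp_add]; congr 1; push_cast [Prod.fst_add, Prod.snd_add]; ring

noncomputable def ev (c : ℤ × ℤ → ℂ) (t x : ℝ) : ℂ := ∑' n, c n * ee n t x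

lemma ev_sum {c : ℤ × ℤ → ℂ} (hc : Summable (fun n => ‖c n‖)) (t x : ℝ) :
    Summable (fun n => ‖c n * ee n t x‖) := by
  simpa [ee_norm] using hc

lemma ev_norm {c : ℤ × ℤ → ℂ} (hc : Summable (fun n => ‖c n‖)) (t x : ℝ) :
    ‖ev c t x‖ ≤ ∑' n, ‖c n‖ := by
  have := norm_tsum_le_tsum_norm (ev_sum hc t x)
  simpa [ev, ee_norm] using this

noncomputable def coef (s : ℕ) (f : A) (n : ℤ × ℤ) : ℂ := f n / (wt s n : ℂ)

lemma coef_norm (s : ℕ) (f : A) (n : ℤ × ℤ) : ‖coef s f n‖ = ‖f n‖ / wt s n := by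
  unfold coef; rw [norm_div, Complex.norm_real, Real.norm_of_nonneg (wt_pos _ _).le]

lemma coef_norm_le (s : ℕ) (f : A) (n : ℤ × ℤ) : ‖coef s f n‖ ≤ ‖f n‖ := by
  rw [coef_norm]; exact div_le_self (norm_nonneg _) (wt_one_le _ _)

lemma coef_summable (s : ℕ) (f : A) : Summable (fun n => ‖coef s f n‖) :=
  Summable.of_nonneg_of_le (fun _ => norm_nonneg _) (coef_norm_le s f) (A_summable f)

lemma coef_wt_summable (s : ℕ) (f : A) : Summable (fun n => ‖coef s f n‖ * wt s n) := by
  have : (fun n => ‖coef s f n‖ * wt s n) = fun n => ‖f n‖ := by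
    ext n; rw [coef_norm, div_mul_cancel₀ _ (wt_pos _ _).ne']
  rw [this]; exact A_summable f

lemma ev_cv (s : ℕ) (f g : A) (t x : ℝ) :
    ev (coef s (cv s f g)) t x = ev (coef s f) t x * ev (coef s g) t x := by
  have hs := (ev_sum (coef_summable s f) t x).mul_norm (ev_sum (coef_summable s g) t x)
  have hs' := (Equiv.summable_iff eqv).2 hs.of_norm
  unfold ev
  rw [tsum_mul_tsum_of_summable_norm (ev_sum (coef_summable s f) t x)
    (ev_sum (coef_summable s g) t x)]
  rw [← Equiv.tsum_eq eqv]
  refine Eq.trans ?_ (Summable.tsum_prod hs').symm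
  congr 1; ext n
  unfold coef
  rw [cv_apply, div_eq_mul_inv, mul_assoc, ← tsum_mul_right]
  congr 1; ext k
  simp only [Function.comp, eqv, Equiv.coe_fn_mk]
  have h1 : ee n t x = ee k t x * ee (n - k) t x := by rw [← ee_add]; simp
  rw [h1, ka]
  have h2 : k + (n - k) = n := by simp
  rw [h2]
  have w1 : (wt s n : ℂ) ≠ 0 := by exact_mod_cast (wt_pos s n).ne'
  have w2 : (wt s k : ℂ) ≠ 0 := by exact_mod_cast (wt_pos s k).ne'
  have w3 : (wt s (n - k) : ℂ) ≠ 0 := by exact_mod_cast (wt_pos s (n - k)).ne'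
  push_cast
  field_simp

lemma ev_pw (s : ℕ) (f : A) (n : ℕ) (t x : ℝ) :
    ev (coef s (pw s f n)) t x = ev (coef s f) t x ^ (n + 1) := by
  induction n with
  | zero => simp [pw]
  | succ n ih =>
    change ev (coef s (cv s f (pw s f n))) t x = _
    rw [ev_cv, ih]; ring

lemma ee_dt (n : ℤ × ℤ) (t x : ℝ) :
    HasDerivAt (fun t => ee n t x) (Complex.I * n.1 * ee n t x) t := by
  have h0 : HasDerivAt (fun t : ℝ => ((n.1 : ℝ) * t + (n.2 : ℝ) * x)) ((n.1 : ℝ)) t := by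
    simpa using ((hasDerivAt_id t).const_mul (n.1 : ℝ)).add_const ((n.2 : ℝ) * x)
  have h := ((h0.ofReal_comp).const_mul Complex.I).cexp
  refine HasDerivAt.congr_deriv h ?_
  unfold ee; push_cast; ring

lemma ee_dx (n : ℤ × ℤ) (t x : ℝ) :
    HasDerivAt (fun x => ee n t x) (Complex.I * n.2 * ee n t x) x := by
  have h0 : HasDerivAt (fun x : ℝ => ((n.1 : ℝ) * t + (n.2 : ℝ) * x)) ((n.2 : ℝ)) x := by
    simpa using ((hasDerivAt_id x).const_mul (n.2 : ℝ)).const_add ((n.1 : ℝ) * t)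
  have h := ((h0.ofReal_comp).const_mul Complex.I).cexp
  refine HasDerivAt.congr_deriv h ?_
  unfold ee; push_cast; ring

lemma ev_dt {c : ℤ × ℤ → ℂ} (hc : Summable (fun n => ‖c n‖))
    (hc' : Summable (fun n : ℤ × ℤ => ‖Complex.I * n.1 * c n‖)) (t x : ℝ) :
    HasDerivAt (fun t => ev c t x) (ev (fun n => Complex.I * n.1 * c n) t x) t := by
  unfold ev
  refine hasDerivAt_tsum (g := fun n t => c n * ee n t x)
    (g' := fun n t => Complex.I * n.1 * c n * ee n t x) hc' ?_ ?_ (ev_sum hc t x).of_norm t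
  · intro n y
    exact HasDerivAt.congr_deriv ((ee_dt n y x).const_mul (c n)) (by ring)
  · intro n y
    rw [norm_mul, ee_norm, mul_one]

lemma ev_dx {c : ℤ × ℤ → ℂ} (hc : Summable (fun n => ‖c n‖))
    (hc' : Summable (fun n : ℤ × ℤ => ‖Complex.I * n.2 * c n‖)) (t x : ℝ) :
    HasDerivAt (fun x => ev c t x) (ev (fun n => Complex.I * n.2 * c n) t x) x := by
  unfold ev
  refine hasDerivAt_tsum (g := fun n x => c n * ee n t x)
    (g' := fun n x => Complex.I * n.2 * c n * ee n t x) hc' ?_ ?_ (ev_sum hc t x).of_norm x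
  · intro n y
    exact HasDerivAt.congr_deriv ((ee_dx n t y).const_mul (c n)) (by ring)
  · intro n y
    rw [norm_mul, ee_norm, mul_one]

noncomputable def lin (n : ℤ × ℤ) : ℝ × ℝ →L[ℝ] ℝ :=
  (n.1 : ℝ) • ContinuousLinearMap.fst ℝ ℝ ℝ + (n.2 : ℝ) • ContinuousLinearMap.snd ℝ ℝ ℝ

lemma lin_norm (n : ℤ × ℤ) : ‖lin n‖ ≤ |(n.1 : ℝ)| + |(n.2 : ℝ)| := by
  unfold lin
  refine (norm_add_le _ _).trans ?_
  rw [norm_smul, norm_smul, Real.norm_eq_abs, Real.norm_eq_abs]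
  have h1 := ContinuousLinearMap.norm_fst_le ℝ ℝ ℝ
  have h2 := ContinuousLinearMap.norm_snd_le ℝ ℝ ℝ
  have := mul_le_of_le_one_right (abs_nonneg (n.1 : ℝ)) h1
  have := mul_le_of_le_one_right (abs_nonneg (n.2 : ℝ)) h2
  linarith

noncomputable def ex (y : ℝ) : ℂ := Complex.exp (Complex.I * y)

lemma ex_contDiff : ContDiff ℝ ⊤ ex := by
  unfold ex
  exact (contDiff_const.mul Complex.ofRealCLM.contDiff).cexp

lemma ex_iter (k : ℕ) : iteratedDeriv k ex = fun y => Complex.I ^ k * ex y := by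
  induction k with
  | zero => simp
  | succ k ih =>
    rw [iteratedDeriv_succ, ih]
    ext y
    have h0 : HasDerivAt ex (Complex.I * ex y) y := by
      have := (((hasDerivAt_id y).ofReal_comp).const_mul Complex.I).cexp
      refine HasDerivAt.congr_deriv this ?_
      simp [ex, mul_comm]
    rw [(h0.const_mul _).deriv]; ring

lemma ee_eq (n : ℤ × ℤ) (q : ℝ × ℝ) : ee n q.1 q.2 = (ex ∘ lin n) q := by
  simp [ee, ex, lin]

lemma ee_iter (n : ℤ × ℤ) (k : ℕ) (q : ℝ × ℝ) :
    ‖iteratedFDeriv ℝ k (ex ∘ lin n) q‖ ≤ (|(n.1 : ℝ)| + |(n.2 : ℝ)|) ^ k := by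
  rw [ContinuousLinearMap.iteratedFDeriv_comp_right (lin n) (ex_contDiff.of_le le_top : ContDiff ℝ k ex)
    q le_rfl]
  refine (ContinuousMultilinearMap.norm_compContinuousLinearMap_le _ _).trans ?_
  rw [norm_iteratedFDeriv_eq_norm_iteratedDeriv, ex_iter]
  have : ‖ex (lin n q)‖ = 1 := by
    rw [← Function.comp_apply (f := ex), ← ee_eq, ee_norm]
  simp only [norm_mul, norm_pow, Complex.norm_I, one_pow, this, one_mul, Finset.prod_const,
    Finset.card_univ, Fintype.card_fin]
  exact pow_le_pow_left₀ (norm_nonneg _) (lin_norm n) k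

lemma ev_contDiff {c : ℤ × ℤ → ℂ} (s : ℕ) (hc : Summable (fun n => ‖c n‖ * wt s n)) :
    ContDiff ℝ s (fun q : ℝ × ℝ => ev c q.1 q.2) := by
  have e : (fun q : ℝ × ℝ => ev c q.1 q.2) = fun q => ∑' n, c n • (ex ∘ lin n) q := by
    ext q; unfold ev; exact tsum_congr (fun n => by rw [ee_eq]; rfl)
  rw [e]
  have hcd : ∀ n, ContDiff ℝ s (ex ∘ lin n) := fun n =>
    (ex_contDiff.of_le le_top).comp (lin n).contDiff
  refine contDiff_tsum (N := (s : ℕ∞)) (f := fun n q => c n • (ex ∘ lin n) q)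
    (v := fun _ n => ‖c n‖ * wt s n) ?_ (fun _ _ => hc) ?_
  · intro n; exact (hcd n).const_smul (c n)
  · intro k n q hk
    have hk' : k ≤ s := by exact_mod_cast hk
    have h1 : ContDiffAt ℝ k (ex ∘ lin n) q :=
      ((hcd n).of_le (by exact_mod_cast hk')).contDiffAt
    rw [show (fun q => c n • (ex ∘ lin n) q) = c n • (ex ∘ lin n) from rfl,
      iteratedFDeriv_const_smul_apply h1, norm_smul]
    gcongr
    refine (ee_iter n k q).trans ?_
    unfold wt
    have hb : (|(n.1 : ℝ)| + |(n.2 : ℝ)|) ≤ (1 + |(n.1 : ℝ)|) * (1 + |(n.2 : ℝ)|) := by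
      nlinarith [mul_nonneg (abs_nonneg (n.1 : ℝ)) (abs_nonneg (n.2 : ℝ))]
    have hb1 : 1 ≤ (1 + |(n.1 : ℝ)|) * (1 + |(n.2 : ℝ)|) := by
      nlinarith [mul_nonneg (abs_nonneg (n.1 : ℝ)) (abs_nonneg (n.2 : ℝ)), abs_nonneg (n.1 : ℝ),
        abs_nonneg (n.2 : ℝ)]
    exact (pow_le_pow_left₀ (by positivity) hb k).trans (pow_le_pow_right₀ hb1 hk')

/-! reality, oddness, periodicity -/
lemma ev_im {c : ℤ × ℤ → ℂ} (h : ∀ n, c (-n) = starRingEnd ℂ (c n)) (t x : ℝ) :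
    (ev c t x).im = 0 := by
  apply Complex.conj_eq_iff_im.1
  unfold ev
  rw [Complex.conj_tsum, ← Equiv.tsum_eq (Equiv.neg (ℤ × ℤ))]
  congr 1; ext n
  simp only [Equiv.neg_apply, map_mul, h, Complex.conj_conj]
  congr 1
  unfold ee; rw [← Complex.exp_conj]; congr 1
  simp; ring

lemma ee_x0 (n : ℤ × ℤ) (t x : ℝ) (hx : x = 0 ∨ x = Real.pi) : ee (rf n) t x = ee n t x := by
  rcases hx with rfl | rfl
  · simp [ee, rf]
  · unfold ee rf
    rw [Complex.exp_eq_exp_iff_exists_int]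
    refine ⟨-n.2, ?_⟩
    push_cast; ring

lemma ev_x0 {c : ℤ × ℤ → ℂ} (h : ∀ n, c (rf n) = - c n) (t x : ℝ) (hx : x = 0 ∨ x = Real.pi) :
    ev c t x = 0 := by
  have : ev c t x = - ev c t x := by
    conv_lhs => unfold ev
    rw [← Equiv.tsum_eq rfE]
    unfold ev; rw [← tsum_neg]
    congr 1; ext n
    have : rfE n = rf n := rfl
    rw [this, h, ee_x0 n t x hx]; ring
  exact self_eq_neg.1 this

lemma ev_per (c : ℤ × ℤ → ℂ) (t x : ℝ) : ev c (t + 2 * Real.pi) x = ev c t x := by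
  unfold ev; congr 1; ext n; congr 1
  unfold ee
  rw [Complex.exp_eq_exp_iff_exists_int]
  refine ⟨n.1, ?_⟩
  push_cast; ring

end SDB

namespace SDB

def Ker (n : ℤ × ℤ) : Prop := n.1 ^ 2 = 1 ∧ n.2 ^ 2 = 1

instance (n : ℤ × ℤ) : Decidable (Ker n) := by unfold Ker; infer_instance

lemma ker_iff (n : ℤ × ℤ) : Ker n ↔ n = (1,1) ∨ n = (1,-1) ∨ n = (-1,1) ∨ n = (-1,-1) := by
  obtain ⟨j, k⟩ := n
  simp only [Ker, sq_eq_one_iff, Prod.mk.injEq]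
  tauto

noncomputable def Ef (s : ℕ) (n : ℤ × ℤ) : ℂ :=
  if Ker n then (wt s n / 4 : ℝ) * ((n.1 : ℂ) * n.2) else 0

lemma Ef_summable (s : ℕ) : Summable (fun n => ‖Ef s n‖) := by
  apply summable_of_ne_finset_zero (s := {(1,1), (1,-1), (-1,1), (-1,-1)})
  intro n hn
  have : ¬ Ker n := by
    rw [ker_iff]; simpa using hn
  simp [Ef, this]

noncomputable def E (s : ℕ) : A := mk (Ef s) (Ef_summable s)

lemma E_apply (s : ℕ) (n : ℤ × ℤ) :
    E s n = if Ker n then ((wt s n / 4 : ℝ) : ℂ) * ((n.1 : ℂ) * n.2) else 0 := rfl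

lemma E_real (s : ℕ) : IsReal (E s) := by
  intro n
  have : Ker (-n) ↔ Ker n := by simp [Ker]
  rw [E_apply, E_apply]
  simp only [this, wt_neg]
  split_ifs
  · rw [map_mul, Complex.conj_ofReal, map_mul]; simp
  · simp

lemma E_odd (s : ℕ) : IsOdd (E s) := by
  intro n
  have : Ker (rf n) ↔ Ker n := by simp [Ker, rf]
  rw [E_apply, E_apply]
  simp only [this, wt_rf]
  split_ifs <;> simp [rf]

lemma E_supp (s : ℕ) (n : ℤ × ℤ) (hn : 1 < |n.2|) : E s n = 0 := by
  rw [E_apply, if_neg]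
  rintro ⟨_, h⟩
  rw [← sq_abs] at h
  nlinarith

lemma E_11 (s : ℕ) : E s (1,1) = ((wt s (1,1) / 4 : ℝ) : ℂ) := by
  rw [E_apply, if_pos (by simp [Ker])]; simp

/-! positivity -/
noncomputable def chi (n : ℤ × ℤ) : ℂ := Complex.I ^ (n.1 + n.2)

lemma chi_add (k l : ℤ × ℤ) : chi (k + l) = chi k * chi l := by
  unfold chi; rw [← zpow_add₀ Complex.I_ne_zero]; congr 1; simp; ring

def PosC (f : A) (r : ℤ × ℤ → ℝ) : Prop := (∀ n, 0 ≤ r n) ∧ ∀ n, f n = r n * chi n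

lemma chi_norm (n : ℤ × ℤ) : ‖chi n‖ = 1 := by simp [chi]

lemma PosC.cv (s : ℕ) {f g : A} {r r' : ℤ × ℤ → ℝ} (hf : PosC f r) (hg : PosC g r') :
    ∃ r'', PosC (cv s f g) r'' ∧ ∀ n k, 0 < r k → 0 < r' (n - k) → 0 < r'' n := by
  have hsum : ∀ n, Summable (fun k => ka s k (n - k) * (r k * r' (n - k))) := by
    intro n
    convert conv_term_summable s f g n using 2 with k
    simp only [cterm]
    rw [norm_mul, norm_mul, hf.2, hg.2, norm_mul, norm_mul, chi_norm, chi_norm]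
    simp only [Complex.norm_real, mul_one]
    rw [Real.norm_of_nonneg (ka_pos _ _ _).le, Real.norm_of_nonneg (hf.1 _),
      Real.norm_of_nonneg (hg.1 _)]
  have hnn : ∀ n k, 0 ≤ ka s k (n - k) * (r k * r' (n - k)) := fun n k =>
    mul_nonneg (ka_pos _ _ _).le (mul_nonneg (hf.1 _) (hg.1 _))
  refine ⟨fun n => ∑' k, ka s k (n - k) * (r k * r' (n - k)), ⟨fun n => tsum_nonneg (hnn n), ?_⟩, ?_⟩
  · intro n
    rw [cv_apply, Complex.ofReal_tsum, ← tsum_mul_right]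
    congr 1; ext k
    have : chi n = chi k * chi (n - k) := by rw [← chi_add]; simp
    rw [hf.2, hg.2, this]; push_cast; ring
  · intro n k h1 h2
    exact (hsum n).tsum_pos (hnn n) k (mul_pos (ka_pos _ _ _) (mul_pos h1 h2))

lemma posE (s : ℕ) : PosC (-(E s)) (fun n => if Ker n then wt s n / 4 else 0) := by
  constructor
  · intro n; dsimp only; split_ifs
    · have := wt_pos s n; positivity
    · exact le_rfl
  · intro n
    rw [neg_apply, E_apply]
    by_cases h : Ker n
    · simp only [h, if_true]
      have : -((n.1 : ℂ) * n.2) = chi n := by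
        rcases (ker_iff n).1 h with rfl | rfl | rfl | rfl
        · simp only [chi]; rw [show (1 : ℤ) + 1 = 2 by norm_num]; simp [zpow_ofNat]
        · simp [chi]
        · simp [chi]
        · simp only [chi]; rw [show (-1 : ℤ) + -1 = -2 by norm_num, zpow_neg]; simp [zpow_ofNat]
      rw [← this]; ring
    · simp [h]

lemma pw_pos (s p : ℕ) : ∃ r, PosC (pw s (-(E s)) (2 * p)) r ∧ 0 < r (1,1) := by
  induction p with
  | zero =>
    refine ⟨_, posE s, ?_⟩
    rw [if_pos (by simp [Ker])]
    have := wt_pos s (1,1); positivity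
  | succ p ih =>
    obtain ⟨r, hr, hp⟩ := ih
    obtain ⟨r1, hr1, hp1⟩ := PosC.cv s (posE s) hr
    obtain ⟨r2, hr2, hp2⟩ := PosC.cv s (posE s) hr1
    refine ⟨r2, hr2, ?_⟩
    apply hp2 (1,1) (1,1)
    · rw [if_pos (by simp [Ker])]
      have := wt_pos s (1,1); positivity
    · apply hp1 _ (-1,-1)
      · rw [if_pos (by simp [Ker])]
        have := wt_pos s (-1,-1); positivity
      · simpa using hp

lemma pw_neg (s : ℕ) (f : A) (n : ℕ) : ∀ k, pw s (-f) n k = (-1) ^ (n + 1) * pw s f n k := by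
  induction n with
  | zero => intro k; simp [pw]
  | succ n ih =>
    intro k
    change cv s (-f) (pw s (-f) n) k = _ * cv s f (pw s f n) k
    rw [cv_apply, cv_apply, ← tsum_mul_left]
    congr 1; ext l
    rw [ih, neg_apply]; ring

lemma NE_11 (s p : ℕ) : ∃ r : ℝ, 0 < r ∧ pw s (E s) (2 * p) (1,1) = r := by
  obtain ⟨r, hr, hp⟩ := pw_pos s p
  refine ⟨r (1,1), hp, ?_⟩
  have h1 := pw_neg s (E s) (2 * p) (1,1)
  rw [hr.2, pow_succ, pow_mul] at h1
  have : chi (1,1) = -1 := by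
    simp only [chi]; rw [show (1 : ℤ) + 1 = 2 by norm_num]; simp [zpow_ofNat]
  rw [this] at h1
  simp at h1
  exact h1.symm

lemma A0 (s p : ℕ) : ∃ a : ℝ, 0 < a ∧ pw s (E s) (2 * p) (1,1) / E s (1,1) = a := by
  obtain ⟨r, hr, h⟩ := NE_11 s p
  have := wt_pos s (1,1)
  refine ⟨r / (wt s (1,1) / 4), by positivity, ?_⟩
  rw [h, E_11]; push_cast; rfl

/-! divisors -/
noncomputable def D (m : ℝ) (n : ℤ × ℤ) : ℝ := (n.2 : ℝ) ^ 2 + m - (1 + m) * (n.1 : ℝ) ^ 2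

lemma D_ne {m : ℝ} (hm : Irrational m) {n : ℤ × ℤ} (hn : ¬ Ker n) : D m n ≠ 0 := by
  intro h
  unfold D at h
  by_cases h1 : n.1 ^ 2 = 1
  · apply hn
    refine ⟨h1, ?_⟩
    have h1' : (n.1 : ℝ) ^ 2 = 1 := by exact_mod_cast h1
    rw [h1'] at h
    have : (n.2 : ℝ) ^ 2 = 1 := by linarith
    exact_mod_cast this
  · have h1' : (n.1 : ℝ) ^ 2 - 1 ≠ 0 := by
      intro h2
      apply h1
      have : (n.1 : ℝ) ^ 2 = 1 := by linarith
      exact_mod_cast this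
    apply hm
    refine ⟨((n.2 : ℚ) ^ 2 - (n.1 : ℚ) ^ 2) / ((n.1 : ℚ) ^ 2 - 1), ?_⟩
    push_cast
    rw [div_eq_iff h1']
    linarith

lemma int_abs_le_sq (j : ℤ) : |(j : ℝ)| ≤ (j : ℝ) ^ 2 := by
  have : |j| ≤ j ^ 2 := by
    rw [← sq_abs]
    rcases eq_or_ne j 0 with rfl | h
    · simp
    · have := Int.one_le_abs h
      nlinarith
  exact_mod_cast this

lemma D_low {m : ℝ} (hm0 : 0 < m) (hm : Irrational m) (N : ℕ) : ∃ C : ℝ, 0 < C ∧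
    ∀ n : ℤ × ℤ, ¬ Ker n → |n.2| ≤ N → |(n.1 : ℝ)| ≤ C * |D m n| := by
  obtain ⟨J, hJ⟩ := exists_nat_ge (((N : ℝ) ^ 2 + m) / m)
  let F : Finset (ℤ × ℤ) := Finset.Icc (-(J : ℤ)) J ×ˢ Finset.Icc (-(N : ℤ)) N
  have hnn : ∀ n ∈ F, 0 ≤ |(n.1 : ℝ)| / |D m n| := fun n _ => by positivity
  have hS := Finset.sum_nonneg hnn
  refine ⟨1 + ∑ n ∈ F, |(n.1 : ℝ)| / |D m n|, by linarith, fun n hn hN => ?_⟩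
  have hD : 0 < |D m n| := abs_pos.2 (D_ne hm hn)
  by_cases hj : |n.1| ≤ J
  · have hF : n ∈ F := by
      simp only [F, Finset.mem_product, Finset.mem_Icc]
      exact ⟨abs_le.1 hj, abs_le.1 hN⟩
    have := Finset.single_le_sum hnn hF
    rw [← div_le_iff₀ hD]
    linarith
  · push Not at hj
    have hj' : (J : ℝ) ≤ |(n.1 : ℝ)| := by exact_mod_cast hj.le
    have h2 := int_abs_le_sq n.1
    have h3 : ((N : ℝ) ^ 2 + m) ≤ (n.1 : ℝ) ^ 2 * m := by
      rw [← div_le_iff₀ hm0]; linarith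
    have hN' : |(n.2 : ℝ)| ≤ N := by exact_mod_cast hN
    have h4 : (n.2 : ℝ) ^ 2 ≤ (N : ℝ) ^ 2 := by
      rw [← sq_abs]; exact pow_le_pow_left₀ (abs_nonneg _) hN' 2
    have h5 : (n.1 : ℝ) ^ 2 ≤ |D m n| := by
      refine le_trans ?_ (neg_le_abs _)
      unfold D; nlinarith
    nlinarith [mul_nonneg hS hD.le]

lemma D_sq {m : ℝ} (hm0 : 0 < m) : ∃ C : ℝ, 0 < C ∧
    ∀ n : ℤ × ℤ, ¬ Ker n → (n.2 : ℝ) ^ 2 ≤ |(n.1 : ℝ)| → (n.1 : ℝ) ^ 2 ≤ C * |D m n| := by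
  refine ⟨4 / (3 * m) + 1, by positivity, fun n hn h => ?_⟩
  have h0 : 0 ≤ |D m n| := abs_nonneg _
  rcases lt_trichotomy (n.1 ^ 2) 1 with h1 | h1 | h1
  · have : n.1 = 0 := by nlinarith [sq_nonneg n.1, sq_eq_zero_iff.1 (show n.1 ^ 2 = 0 by nlinarith [sq_nonneg n.1])]
    rw [this]; simp; positivity
  · have h2 : |n.1| = 1 := by rcases sq_eq_one_iff.1 h1 with h | h <;> simp [h]
    have h2' : |(n.1 : ℝ)| = 1 := by exact_mod_cast h2
    rw [h2'] at h
    have h3 : n.2 ^ 2 ≤ 1 := by exact_mod_cast h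
    have h4 : n.2 ^ 2 ≠ 1 := fun h5 => hn ⟨h1, h5⟩
    have h5 : n.2 ^ 2 = 0 := by have := sq_nonneg n.2; omega
    have h5' : (n.2 : ℝ) ^ 2 = 0 := by exact_mod_cast h5
    have h1' : (n.1 : ℝ) ^ 2 = 1 := by exact_mod_cast h1
    have : D m n = -1 := by unfold D; rw [h5', h1']; ring
    rw [this, h1']; simp; positivity
  · have h2 : 4 ≤ n.1 ^ 2 := by
      rw [← sq_abs] at h1 ⊢
      have h3 : 1 < |n.1| := by
        by_contra h4
        push Not at h4
        nlinarith [abs_nonneg n.1]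
      nlinarith
    have h2' : (4 : ℝ) ≤ (n.1 : ℝ) ^ 2 := by exact_mod_cast h2
    have h3 := int_abs_le_sq n.1
    have h5 : 3 * m / 4 * (n.1 : ℝ) ^ 2 ≤ |D m n| := by
      refine le_trans ?_ (neg_le_abs _)
      unfold D; nlinarith
    have h6 : (n.1 : ℝ) ^ 2 ≤ 4 / (3 * m) * |D m n| := by
      calc (n.1 : ℝ) ^ 2 = 4 / (3 * m) * (3 * m / 4 * (n.1 : ℝ) ^ 2) := by field_simp
        _ ≤ _ := by gcongr
    linarith

noncomputable def l0 (m a h : ℝ) (n : ℤ × ℤ) : ℂ :=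
  (D m n : ℂ) + Complex.I * (h * a * n.1 * n.2 ^ 2 : ℝ)

lemma l0_re (m a h : ℝ) (n : ℤ × ℤ) : |D m n| ≤ ‖l0 m a h n‖ := by
  have := Complex.abs_re_le_norm (l0 m a h n)
  simpa [l0, -Complex.ofReal_mul, -Complex.ofReal_pow] using this

lemma l0_im (m a h : ℝ) (n : ℤ × ℤ) : |h * a * n.1 * n.2 ^ 2| ≤ ‖l0 m a h n‖ := by
  have := Complex.abs_im_le_norm (l0 m a h n)
  simpa [l0, -Complex.ofReal_mul, -Complex.ofReal_pow] using this

noncomputable def nu (m a h : ℝ) (n : ℤ × ℤ) : ℂ := if Ker n then 0 else (l0 m a h n)⁻¹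

noncomputable def mu1 (m a h : ℝ) (n : ℤ × ℤ) : ℂ := Complex.I * (h * n.1 : ℝ) * nu m a h n
noncomputable def mu2 (m a h : ℝ) (n : ℤ × ℤ) : ℂ := (h * n.1 ^ 2 : ℝ) * nu m a h n
noncomputable def mu3 (m a h : ℝ) (n : ℤ × ℤ) : ℂ :=
  Complex.I * (h * n.1 * n.2 ^ 2 : ℝ) * nu m a h n

lemma l0_neg (m a h : ℝ) (n : ℤ × ℤ) : l0 m a h (-n) = starRingEnd ℂ (l0 m a h n) := by
  simp [l0, D]

lemma nu_neg (m a h : ℝ) (n : ℤ × ℤ) : nu m a h (-n) = starRingEnd ℂ (nu m a h n) := by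
  have : Ker (-n) ↔ Ker n := by simp [Ker]
  simp only [nu, this, l0_neg]
  split_ifs <;> simp

lemma nu_rf (m a h : ℝ) (n : ℤ × ℤ) : nu m a h (rf n) = nu m a h n := by
  have : Ker (rf n) ↔ Ker n := by simp [Ker, rf]
  simp only [nu, this]
  simp [l0, D, rf]

lemma mu1_neg (m a h : ℝ) (n : ℤ × ℤ) : mu1 m a h (-n) = starRingEnd ℂ (mu1 m a h n) := by
  simp [mu1, nu_neg]
lemma mu2_neg (m a h : ℝ) (n : ℤ × ℤ) : mu2 m a h (-n) = starRingEnd ℂ (mu2 m a h n) := by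
  simp [mu2, nu_neg]
lemma mu3_neg (m a h : ℝ) (n : ℤ × ℤ) : mu3 m a h (-n) = starRingEnd ℂ (mu3 m a h n) := by
  simp [mu3, nu_neg]
lemma mu1_rf (m a h : ℝ) (n : ℤ × ℤ) : mu1 m a h (rf n) = mu1 m a h n := by
  simp [mu1, nu_rf]; simp [rf]
lemma mu2_rf (m a h : ℝ) (n : ℤ × ℤ) : mu2 m a h (rf n) = mu2 m a h n := by
  simp [mu2, nu_rf]; simp [rf]
lemma mu3_rf (m a h : ℝ) (n : ℤ × ℤ) : mu3 m a h (rf n) = mu3 m a h n := by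
  simp [mu3, nu_rf]; simp [rf]

/-- generic bound -/
lemma nu_bound {m a h X C : ℝ} {n : ℤ × ℤ} (hC : 0 ≤ C)
    (hb : ¬ Ker n → l0 m a h n ≠ 0) (H : ¬ Ker n → |X| ≤ C * ‖l0 m a h n‖) :
    ‖((X : ℝ) : ℂ) * nu m a h n‖ ≤ C := by
  unfold nu
  split_ifs with hk
  · simpa using hC
  · rw [norm_mul, norm_inv, Complex.norm_real, Real.norm_eq_abs, ← div_eq_mul_inv,
      div_le_iff₀ (norm_pos_iff.2 (hb hk))]
    exact H hk

lemma mu_bounds {m : ℝ} (hm0 : 0 < m) (hm : Irrational m) {a : ℝ} (ha : 0 < a) (N0 : ℕ) :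
    ∃ C : ℝ, 0 < C ∧ ∀ η : ℝ, 0 < η → ∃ h0 : ℝ, 0 < h0 ∧ ∀ h : ℝ, 0 < h → h < h0 →
      (∀ n, ‖mu1 m a h n‖ ≤ η) ∧ (∀ n : ℤ × ℤ, |n.2| ≤ N0 → ‖mu1 m a h n‖ ≤ C * h) ∧
      (∀ n, ‖mu2 m a h n‖ ≤ C) ∧ (∀ n, ‖mu3 m a h n‖ ≤ C) := by
  obtain ⟨C0, hC0, H0⟩ := D_low hm0 hm N0
  obtain ⟨C2, hC2, H2⟩ := D_sq hm0
  refine ⟨C0 + C2 + 1 / a, by positivity, fun η hη => ?_⟩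
  obtain ⟨N, hN⟩ := exists_nat_ge (1 / (a * η))
  obtain ⟨C1, hC1, H1⟩ := D_low hm0 hm N
  refine ⟨min 1 (η / C1), by positivity, fun h hh hlt => ?_⟩
  have hh1 : h ≤ 1 := (hlt.trans_le (min_le_left _ _)).le
  have hh2 : h * C1 ≤ η := by
    rw [← le_div_iff₀ hC1]; exact (hlt.trans_le (min_le_right _ _)).le
  have hne : ∀ n, ¬ Ker n → l0 m a h n ≠ 0 := by
    intro n hn h0
    have h1 := l0_re m a h n
    rw [h0, norm_zero] at h1
    exact absurd h1 (not_le.2 (abs_pos.2 (D_ne hm hn)))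
  have him : ∀ n, h * a * |(n.1 : ℝ)| * (n.2 : ℝ) ^ 2 ≤ ‖l0 m a h n‖ := by
    intro n
    have := l0_im m a h n
    rwa [abs_mul, abs_mul, abs_of_pos (mul_pos hh ha), abs_of_nonneg (sq_nonneg (n.2 : ℝ))] at this
  have e1 : ∀ n, ‖mu1 m a h n‖ = ‖((h * n.1 : ℝ) : ℂ) * nu m a h n‖ := by
    intro n; simp [mu1]
  have e3 : ∀ n, ‖mu3 m a h n‖ = ‖((h * n.1 * n.2 ^ 2 : ℝ) : ℂ) * nu m a h n‖ := by
    intro n; simp [mu3]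
  have habs : ∀ n : ℤ × ℤ, |h * (n.1 : ℝ)| = h * |(n.1 : ℝ)| := fun n => by
    rw [abs_mul, abs_of_pos hh]
  have low : ∀ (C : ℝ) (n : ℤ × ℤ), 0 < C → (|(n.1 : ℝ)| ≤ C * |D m n|) →
      h * |(n.1 : ℝ)| ≤ C * h * ‖l0 m a h n‖ := by
    intro C n hC hn
    calc h * |(n.1 : ℝ)| ≤ h * (C * |D m n|) := by gcongr
      _ ≤ h * (C * ‖l0 m a h n‖) := by gcongr; exact l0_re m a h n
      _ = _ := by ring
  refine ⟨fun n => ?_, fun n hn => ?_, fun n => ?_, fun n => ?_⟩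
  · rw [e1]
    apply nu_bound hη.le (hne n)
    intro hk
    rw [habs]
    by_cases hN' : |n.2| ≤ N
    · refine (low C1 n hC1 (H1 n hk hN')).trans ?_
      have := norm_nonneg (l0 m a h n)
      nlinarith
    · push Not at hN'
      have h1 : (N : ℝ) ≤ |(n.2 : ℝ)| := by exact_mod_cast hN'.le
      have h2 := int_abs_le_sq n.2
      have h3 : 1 ≤ (n.2 : ℝ) ^ 2 * (a * η) := by
        rw [← div_le_iff₀ (by positivity)]; linarith
      calc h * |(n.1 : ℝ)| ≤ (h * |(n.1 : ℝ)|) * ((n.2 : ℝ) ^ 2 * (a * η)) :=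
            le_mul_of_one_le_right (by positivity) h3
        _ = η * (h * a * |(n.1 : ℝ)| * (n.2 : ℝ) ^ 2) := by ring
        _ ≤ _ := by gcongr; exact him n
  · rw [e1]
    apply nu_bound (by positivity) (hne n)
    intro hk
    rw [habs]
    refine (low C0 n hC0 (H0 n hk hn)).trans ?_
    have : C0 ≤ C0 + C2 + 1 / a := by
      have : 0 < 1 / a := by positivity
      linarith
    gcongr
  · unfold mu2
    apply nu_bound (by positivity) (hne n)
    intro hk
    rw [abs_of_nonneg (by positivity)]
    rcases le_total ((n.2 : ℝ) ^ 2) |(n.1 : ℝ)| with hc | hc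
    · calc h * (n.1 : ℝ) ^ 2 ≤ 1 * (C2 * |D m n|) := by gcongr; exact H2 n hk hc
        _ ≤ C2 * ‖l0 m a h n‖ := by rw [one_mul]; gcongr; exact l0_re m a h n
        _ ≤ _ := by
          gcongr
          have : 0 < 1 / a := by positivity
          linarith
    · calc h * (n.1 : ℝ) ^ 2 = 1 / a * (h * a * |(n.1 : ℝ)| * |(n.1 : ℝ)|) := by
            rw [← sq_abs]; field_simp
        _ ≤ 1 / a * (h * a * |(n.1 : ℝ)| * (n.2 : ℝ) ^ 2) := by gcongr
        _ ≤ 1 / a * ‖l0 m a h n‖ := by gcongr; exact him n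
        _ ≤ _ := by gcongr; linarith
  · rw [e3]
    apply nu_bound (by positivity) (hne n)
    intro hk
    rw [abs_mul, habs, abs_of_nonneg (sq_nonneg (n.2 : ℝ))]
    calc h * |(n.1 : ℝ)| * (n.2 : ℝ) ^ 2 = 1 / a * (h * a * |(n.1 : ℝ)| * (n.2 : ℝ) ^ 2) := by
            field_simp
        _ ≤ 1 / a * ‖l0 m a h n‖ := by gcongr; exact him n
        _ ≤ _ := by gcongr; linarith

end SDB

namespace SDB

@[simp] lemma smul_apply (c : ℂ) (f : A) (n : ℤ × ℤ) : (c • f) n = c * f n := rfl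

lemma cont_coord (n : ℤ × ℤ) : Continuous (fun f : A => f n) := by
  apply LipschitzWith.continuous (K := 1)
  apply LipschitzWith.of_dist_le_mul
  intro f g
  rw [dist_eq_norm, dist_eq_norm, ← sub_apply]
  simpa using A_coef (f - g) n

lemma closed_real : IsClosed {f : A | IsReal f} := by
  have : {f : A | IsReal f} = ⋂ n, {f : A | f (-n) = starRingEnd ℂ (f n)} := by
    ext f; simp [IsReal]
  rw [this]
  exact isClosed_iInter fun n => isClosed_eq (cont_coord _)
    (Complex.continuous_conj.comp (cont_coord _))

lemma closed_odd : IsClosed {f : A | IsOdd f} := by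
  have : {f : A | IsOdd f} = ⋂ n, {f : A | f (rf n) = - (f n)} := by
    ext f; simp [IsOdd]
  rw [this]
  exact isClosed_iInter fun n => isClosed_eq (cont_coord _) (cont_coord _).neg

lemma fixed_point (S : Set A) (hS : IsClosed S) (h0 : (0 : A) ∈ S) (T : A → A)
    (hT : ∀ f ∈ S, T f ∈ S) (hc : ∀ f ∈ S, ∀ g ∈ S, ‖T f - T g‖ ≤ 1 / 2 * ‖f - g‖) :
    ∃ f ∈ S, T f = f := by
  have hmt : Set.MapsTo T S S := hT
  have hcon : ContractingWith (1/2) (Set.MapsTo.restrict T S S hmt) := by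
    refine ⟨by rw [← NNReal.coe_lt_coe]; norm_num, LipschitzWith.of_dist_le_mul ?_⟩
    rintro ⟨f, hf⟩ ⟨g, hg⟩
    simp only [Subtype.dist_eq, Set.MapsTo.val_restrict_apply, dist_eq_norm]
    have := hc f hf g hg
    push_cast
    exact this
  obtain ⟨y, hy, hfix, _⟩ := ContractingWith.exists_fixedPoint' hS.isComplete hmt hcon h0
    (edist_ne_top _ _)
  exact ⟨y, hy, hfix⟩

lemma mult_sub {μ : ℤ × ℤ → ℂ} {C : ℝ} (h : ∀ n, ‖μ n‖ ≤ C) (f g : A) :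
    mult μ f - mult μ g = mult μ (f - g) := by
  have h' : ∀ f : A, ∀ n, ‖μ n * f n‖ ≤ C * ‖f n‖ := fun f n => by
    rw [norm_mul]; gcongr; exact h n
  apply A_ext; intro n
  rw [sub_apply, mult_apply (h' f), mult_apply (h' g), mult_apply (h' _), sub_apply]; ring

lemma mult_norm' {μ : ℤ × ℤ → ℂ} {C : ℝ} (h : ∀ n, ‖μ n‖ ≤ C) (f : A) :
    ‖mult μ f‖ ≤ C * ‖f‖ :=
  mult_norm (fun n => by rw [norm_mul]; gcongr; exact h n)

lemma mult_apply' {μ : ℤ × ℤ → ℂ} {C : ℝ} (h : ∀ n, ‖μ n‖ ≤ C) (f : A) (n : ℤ × ℤ) :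
    mult μ f n = μ n * f n :=
  mult_apply (C := C) (fun n => by rw [norm_mul]; gcongr; exact h n) n

set_option maxHeartbeats 1600000 in
theorem core {m : ℝ} (hm0 : 0 < m) (hm : Irrational m) (s p : ℕ) :
    ∃ K > (0:ℝ), ∃ h0 > (0:ℝ), ∃ a0 > (0:ℝ), ∀ h : ℝ, 0 < h → h < h0 →
      ∃ q : A, ‖q‖ ≤ K * h ∧ IsReal q ∧ IsOdd q ∧ (∀ n, Ker n → q n = 0) ∧
      ‖pw s (E s + q) (2 * p)‖ ≤ K ∧ ∃ z : ℂ, |z.re - a0| ≤ K * h ∧ |z.im| ≤ K * h ∧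
      ∀ n, (E s + q) n * ((D m n - h * z.im * n.1 ^ 2 : ℝ) + Complex.I * (h * z.re * n.1 * n.2 ^ 2 : ℝ))
        = Complex.I * (h * n.1 : ℝ) * pw s (E s + q) (2 * p) n := by
  obtain ⟨a0, ha0, hA0⟩ := A0 s p
  obtain ⟨Λ, hΛ, hlip⟩ := pw_lip s (‖E s‖ + 1) (by positivity) (2 * p)
  obtain ⟨C, hC, hmu⟩ := mu_bounds hm0 hm ha0 (2 * p + 1)
  obtain ⟨h1, hh1, hmu⟩ := hmu (1 / (4 * (Λ + 1))) (by positivity)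
  have hE11 : 0 < ‖E s (1,1)‖ := by
    rw [E_11, Complex.norm_real, Real.norm_eq_abs, abs_pos]
    have := wt_pos s (1,1); positivity
  set NE := pw s (E s) (2 * p) with hNE
  set N : A → A := fun q => pw s (E s + q) (2 * p) with hNdef
  set G : A → ℂ := fun q => N q (1,1) / E s (1,1) with hG
  set L : ℝ := Λ / ‖E s (1,1)‖ with hL
  have hL0 : 0 ≤ L := by positivity
  set K : ℝ := 2 * C * ‖NE‖ + 1 with hK
  have hK1 : 1 ≤ K := by rw [hK]; have : 0 ≤ 2 * C * ‖NE‖ := by positivity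
                         linarith
  refine ⟨max (K * (L + 1)) ((‖E s‖ + 1) ^ (2 * p + 1)), by positivity,
    min h1 (1 / (16 * (C * L + 1) * K)), by positivity, a0, ha0, fun h hh hlt => ?_⟩
  obtain ⟨b1, b1', b2, b3⟩ := hmu h hh (hlt.trans_le (min_le_left _ _))
  set ε := K * h with hε
  have hε0 : 0 < ε := by positivity
  have hεs : 16 * (C * L + 1) * ε ≤ 1 := by
    have := (hlt.trans_le (min_le_right _ _)).le
    rw [le_div_iff₀ (by positivity)] at this
    rw [hε]; linarith
  have hCL : 0 ≤ C * L := by positivity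
  have hεb : L * ε * C ≤ 1 / 16 := by nlinarith
  have hε1 : ε ≤ 1 := by nlinarith
  have hNlip : ∀ q q' : A, ‖q‖ ≤ ε → ‖q'‖ ≤ ε → ‖N q - N q'‖ ≤ Λ * ‖q - q'‖ := by
    intro q q' hq hq'
    have := hlip (E s + q) (E s + q') ((norm_add_le _ _).trans (by linarith))
      ((norm_add_le _ _).trans (by linarith))
    simpa using this
  have hGlip : ∀ q q' : A, ‖q‖ ≤ ε → ‖q'‖ ≤ ε → ‖G q - G q'‖ ≤ L * ‖q - q'‖ := by
    intro q q' hq hq'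
    simp only [hG]
    rw [← sub_div, norm_div, hL, div_mul_eq_mul_div]
    gcongr
    rw [← sub_apply]
    exact (A_coef _ _).trans (hNlip q q' hq hq')
  have hN0 : N 0 = NE := by simp [hNdef, hNE]
  have hG0 : G 0 = a0 := by simp only [hG]; rw [hN0, hNE, hA0]
  have h0ε : ‖(0 : A)‖ ≤ ε := by simpa using hε0.le
  have hGre : ∀ q : A, ‖q‖ ≤ ε → |(G q).re - a0| ≤ L * ‖q‖ := by
    intro q hq
    have h1 := hGlip q 0 hq h0ε
    rw [hG0, sub_zero] at h1
    have h2 := (Complex.abs_re_le_norm (G q - a0)).trans h1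
    simpa using h2
  have hGim : ∀ q : A, ‖q‖ ≤ ε → |(G q).im| ≤ L * ‖q‖ := by
    intro q hq
    have h1 := hGlip q 0 hq h0ε
    rw [hG0, sub_zero] at h1
    have h2 := (Complex.abs_im_le_norm (G q - a0)).trans h1
    simpa using h2
  set M1 := mult (mu1 m a0 h) with hM1
  set M2 := mult (mu2 m a0 h) with hM2
  set M3 := mult (mu3 m a0 h) with hM3
  have nM1 : ∀ f, ‖M1 f‖ ≤ 1 / (4 * (Λ + 1)) * ‖f‖ := mult_norm' b1
  have nM2 : ∀ f, ‖M2 f‖ ≤ C * ‖f‖ := mult_norm' b2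
  have nM3 : ∀ f, ‖M3 f‖ ≤ C * ‖f‖ := mult_norm' b3
  have nM1' : ‖M1 NE‖ ≤ C * h * ‖NE‖ := by
    apply mult_norm
    intro n
    by_cases hn : |n.2| ≤ (2 * p + 1 : ℕ)
    · rw [norm_mul]; gcongr; exact b1' n hn
    · rw [hNE, pw_supp s (E_supp s) (2 * p) n (by push Not at hn; push_cast at hn ⊢; exact hn)]
      simp
  have hηΛ : 1 / (4 * (Λ + 1)) * Λ ≤ 1 / 4 := by
    rw [div_mul_eq_mul_div, div_le_div_iff₀ (by positivity) (by norm_num)]; nlinarith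
  set T : A → A := fun q => M1 (N q) + (((G q).im : ℝ) : ℂ) • M2 q
    - (((G q).re - a0 : ℝ) : ℂ) • M3 q with hT
  have sub_bd : ∀ (M : A → A) (b b' : ℝ) (q q' : A), (∀ f, ‖M f‖ ≤ C * ‖f‖) →
      (M q - M q' = M (q - q')) → |b| ≤ L * ε → |b - b'| ≤ L * ‖q - q'‖ → ‖q'‖ ≤ ε →
      ‖(b : ℂ) • M q - (b' : ℂ) • M q'‖ ≤ 1 / 8 * ‖q - q'‖ := by
    intro M b b' q q' hM hs hb hbb hq'
    have e : (b : ℂ) • M q - (b' : ℂ) • M q' = (b : ℂ) • M (q - q') + ((b - b' : ℝ) : ℂ) • M q' := by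
      rw [← hs, smul_sub, Complex.ofReal_sub, sub_smul]; abel
    rw [e]
    calc _ ≤ ‖(b : ℂ) • M (q - q')‖ + ‖((b - b' : ℝ) : ℂ) • M q'‖ := norm_add_le _ _
      _ = |b| * ‖M (q - q')‖ + |b - b'| * ‖M q'‖ := by
        rw [norm_smul, norm_smul, Complex.norm_real, Complex.norm_real, Real.norm_eq_abs,
          Real.norm_eq_abs]
      _ ≤ (L * ε) * (C * ‖q - q'‖) + (L * ‖q - q'‖) * (C * ε) := by
        gcongr
        · exact hM _
        · exact (hM _).trans (by gcongr)
      _ = 2 * (L * ε * C) * ‖q - q'‖ := by ring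
      _ ≤ _ := by gcongr; linarith
  have hTlip : ∀ q q' : A, ‖q‖ ≤ ε → ‖q'‖ ≤ ε → ‖T q - T q'‖ ≤ 1 / 2 * ‖q - q'‖ := by
    intro q q' hq hq'
    have e : T q - T q' = M1 (N q - N q')
        + ((((G q).im : ℝ) : ℂ) • M2 q - (((G q').im : ℝ) : ℂ) • M2 q')
        - ((((G q).re - a0 : ℝ) : ℂ) • M3 q - (((G q').re - a0 : ℝ) : ℂ) • M3 q') := by
      rw [hM1, ← mult_sub b1]; simp only [hT]; abel
    have hd := hGlip q q' hq hq'
    have t1 : ‖M1 (N q - N q')‖ ≤ 1 / 4 * ‖q - q'‖ := by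
      calc _ ≤ 1 / (4 * (Λ + 1)) * ‖N q - N q'‖ := nM1 _
        _ ≤ 1 / (4 * (Λ + 1)) * (Λ * ‖q - q'‖) := by gcongr; exact hNlip q q' hq hq'
        _ = 1 / (4 * (Λ + 1)) * Λ * ‖q - q'‖ := by ring
        _ ≤ _ := by gcongr
    have t2 := sub_bd M2 (G q).im (G q').im q q' nM2 (mult_sub b2 _ _)
      ((hGim q hq).trans (by gcongr)) (by
        have := (Complex.abs_im_le_norm (G q - G q')).trans hd; simpa using this) hq'
    have t3 := sub_bd M3 ((G q).re - a0) ((G q').re - a0) q q' nM3 (mult_sub b3 _ _)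
      ((hGre q hq).trans (by gcongr)) (by
        have := (Complex.abs_re_le_norm (G q - G q')).trans hd; simpa using this) hq'
    rw [e]
    refine (norm_sub_le _ _).trans ?_
    have := norm_add_le (M1 (N q - N q'))
      ((((G q).im : ℝ) : ℂ) • M2 q - (((G q').im : ℝ) : ℂ) • M2 q')
    linarith
  have hT0 : ‖T 0‖ ≤ 1 / 2 * ε := by
    have : T 0 = M1 NE := by
      simp only [hT]; rw [hN0, hG0]; simp
    rw [this]
    refine nM1'.trans ?_
    rw [hε, hK]; nlinarith
  have hapT : ∀ q n, T q n = mu1 m a0 h n * N q n + ((G q).im : ℂ) * (mu2 m a0 h n * q n)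
      - (((G q).re - a0 : ℝ) : ℂ) * (mu3 m a0 h n * q n) := by
    intro q n
    simp only [hT]
    rw [sub_apply, add_apply, smul_apply, smul_apply, hM1, hM2, hM3, mult_apply' b1,
      mult_apply' b2, mult_apply' b3]
  obtain ⟨q, ⟨⟨hq, hqr⟩, hqo⟩, hfix⟩ := fixed_point
    (({f : A | ‖f‖ ≤ ε} ∩ {f : A | IsReal f}) ∩ {f : A | IsOdd f})
    (((isClosed_le continuous_norm continuous_const).inter closed_real).inter closed_odd)
    ⟨⟨h0ε, fun n => by simp⟩, fun n => by simp⟩ T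
    (by
      rintro f ⟨⟨hf, hfr⟩, hfo⟩
      have hfr' : IsReal (E s + f) := fun n => by
        rw [add_apply, add_apply, E_real s n, hfr n, map_add]
      have hfo' : IsOdd (E s + f) := fun n => by
        rw [add_apply, add_apply, E_odd s n, hfo n]; ring
      refine ⟨⟨?_, ?_⟩, ?_⟩
      · have hf' : ‖f‖ ≤ ε := hf
        have h1 := hTlip f 0 hf h0ε
        have h2 : T f = (T f - T 0) + T 0 := by abel
        change ‖T f‖ ≤ ε
        rw [h2]
        refine (norm_add_le _ _).trans ?_
        rw [sub_zero] at h1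
        linarith
      · intro n
        have e : N f (-n) = starRingEnd ℂ (N f n) := pw_real s hfr' (2 * p) n
        rw [hapT, hapT, mu1_neg, mu2_neg, mu3_neg, hfr n, e]
        simp only [map_sub, map_add, map_mul, Complex.conj_ofReal]
      · intro n
        have e : N f (rf n) = - N f n := pw_odd s hfo' p n
        rw [hapT, hapT, mu1_rf, mu2_rf, mu3_rf, hfo n, e]
        ring)
    (fun f hf g hg => hTlip f g hf.1.1 hg.1.1)
  have hq' : ‖q‖ ≤ ε := hq
  have hKle : ε ≤ K * (L + 1) * h := by
    rw [hε]; nlinarith [mul_nonneg (mul_nonneg (by linarith : (0:ℝ) ≤ K) hL0) hh.le]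
  have hLle : L * ‖q‖ ≤ K * (L + 1) * h := by
    calc L * ‖q‖ ≤ L * ε := by gcongr
      _ ≤ _ := by rw [hε]; nlinarith [mul_pos (by linarith : (0:ℝ) < K) hh]
  have hmx : K * (L + 1) * h ≤ max (K * (L + 1)) ((‖E s‖ + 1) ^ (2 * p + 1)) * h := by
    gcongr; exact le_max_left _ _
  have hker : ∀ n, Ker n → q n = 0 := by
    intro n hn
    rw [← hfix, hapT]
    simp [mu1, mu2, mu3, nu, hn]
  have hqr' : IsReal (E s + q) := fun n => by
    rw [add_apply, add_apply, E_real s n, hqr n, map_add]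
  have hqo' : IsOdd (E s + q) := fun n => by
    rw [add_apply, add_apply, E_odd s n, hqo n]; ring
  refine ⟨q, hq'.trans (hKle.trans hmx), hqr, hqo, hker, ?_, G q,
    (hGre q hq).trans (hLle.trans hmx), (hGim q hq).trans (hLle.trans hmx), ?_⟩
  · refine (pw_norm _ _ _).trans (le_trans ?_ (le_max_right _ _))
    gcongr
    exact (norm_add_le _ _).trans (by linarith)
  · set LL : ℤ × ℤ → ℂ := fun n => ((D m n - h * (G q).im * n.1 ^ 2 : ℝ) : ℂ)
        + Complex.I * (h * (G q).re * n.1 * n.2 ^ 2 : ℝ) with hLL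
    have hNr : ∀ n, N q (-n) = starRingEnd ℂ (N q n) := pw_real s hqr' (2 * p)
    have hNo : ∀ n, N q (rf n) = - N q n := pw_odd s hqo' p
    have e11 : (E s + q) (1,1) * LL (1,1) = Complex.I * (h * ((1,1) : ℤ × ℤ).1 : ℝ) * N q (1,1) := by
      rw [add_apply, hker (1,1) (by simp [Ker]), add_zero]
      have hne : E s (1,1) ≠ 0 := norm_pos_iff.1 hE11
      have e1 : LL (1,1) = Complex.I * h * G q := by
        have : G q = (G q).re + (G q).im * Complex.I := (Complex.re_add_im _).symm
        conv_rhs => rw [this]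
        simp only [hLL, D]
        push_cast
        linear_combination (-(h : ℂ) * (G q).im) * Complex.I_sq
      rw [e1]
      simp only [hG]
      field_simp
      simp only [Int.cast_one, mul_one]
      ring
    have sneg : ∀ n, (E s + q) n * LL n = Complex.I * (h * n.1 : ℝ) * N q n →
        (E s + q) (-n) * LL (-n) = Complex.I * (h * (-n).1 : ℝ) * N q (-n) := by
      intro n hn
      rw [hqr' n, hNr n]
      have e1 : LL (-n) = starRingEnd ℂ (LL n) := by
        simp only [hLL, D, map_add, map_mul, Complex.conj_ofReal, Complex.conj_I]
        push_cast [Prod.fst_neg, Prod.snd_neg]; ring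
      rw [e1, ← map_mul, hn]
      simp only [map_mul, Complex.conj_ofReal, Complex.conj_I]
      push_cast [Prod.fst_neg]; ring
    have srf : ∀ n, (E s + q) n * LL n = Complex.I * (h * n.1 : ℝ) * N q n →
        (E s + q) (rf n) * LL (rf n) = Complex.I * (h * (rf n).1 : ℝ) * N q (rf n) := by
      intro n hn
      rw [hqo' n, hNo n]
      have e1 : LL (rf n) = LL n := by
        simp only [hLL, D, rf]
        push_cast; ring
      rw [e1, neg_mul, hn]; simp [rf]
    intro n
    by_cases hn : Ker n
    · rcases (ker_iff n).1 hn with rfl | rfl | rfl | rfl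
      · exact e11
      · exact srf _ e11
      · exact srf _ (sneg _ e11)
      · exact sneg _ e11
    · have hEn : E s n = 0 := by rw [E_apply, if_neg hn]
      have h1 := hapT q n
      rw [hfix] at h1
      have hl : l0 m a0 h n ≠ 0 := by
        intro h0
        have h1 := l0_re m a0 h n
        rw [h0, norm_zero] at h1
        exact absurd h1 (not_le.2 (abs_pos.2 (D_ne hm hn)))
      have h2 : q n * l0 m a0 h n = Complex.I * (h * n.1 : ℝ) * N q n
          + ((G q).im : ℂ) * ((h * n.1 ^ 2 : ℝ) * q n)
          - (((G q).re - a0 : ℝ) : ℂ) * (Complex.I * (h * n.1 * n.2 ^ 2 : ℝ) * q n) := by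
        conv_lhs => rw [h1]
        simp only [mu1, mu2, mu3, nu, if_neg hn]
        field_simp
      rw [add_apply, hEn, zero_add]
      simp only [l0] at h2
      push_cast at h2 ⊢
      linear_combination h2

end SDB

namespace SDB

lemma ev_add {c d : ℤ × ℤ → ℂ} (hc : Summable (fun n => ‖c n‖)) (hd : Summable (fun n => ‖d n‖))
    (t x : ℝ) : ev (fun n => c n + d n) t x = ev c t x + ev d t x := by
  unfold ev
  rw [← (ev_sum hc t x).of_norm.tsum_add (ev_sum hd t x).of_norm]
  congr 1; ext n; ring

lemma ev_smul (r : ℂ) (c : ℤ × ℤ → ℂ) (t x : ℝ) : ev (fun n => r * c n) t x = r * ev c t x := by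
  unfold ev
  rw [← tsum_mul_left]
  congr 1; ext n; ring

lemma re_scale {f : ℝ → ℂ} {f' : ℂ} (r ω t : ℝ) (h : HasDerivAt f f' (ω * t)) :
    HasDerivAt (fun t => r * (f (ω * t)).re) (r * ω * f'.re) t := by
  have h1 : HasDerivAt (fun t : ℝ => ω * t) ω t := by
    simpa using (hasDerivAt_id t).const_mul ω
  have h2 := h.scomp t h1
  have h3 := (Complex.reCLM.hasFDerivAt.comp_hasDerivAt t h2).const_mul r
  refine HasDerivAt.congr_deriv h3 ?_
  simp; ring

lemma re_x {f : ℝ → ℂ} {f' : ℂ} (r x : ℝ) (h : HasDerivAt f f' x) :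
    HasDerivAt (fun t => r * (f t).re) (r * f'.re) x := by
  have h3 := (Complex.reCLM.hasFDerivAt.comp_hasDerivAt x h).const_mul r
  exact HasDerivAt.congr_deriv h3 (by simp)

lemma summ_of_bound {c : ℤ × ℤ → ℂ} {s : ℕ} (hs : 3 ≤ s) (hc : Summable (fun n => ‖c n‖ * wt s n))
    (a b : ℕ) (ha : a ≤ 3) (hb : b ≤ 3) (d : ℤ × ℤ → ℂ)
    (hd : ∀ n, ‖d n‖ = |(n.1 : ℝ)| ^ a * |(n.2 : ℝ)| ^ b * ‖c n‖) : Summable (fun n => ‖d n‖) := by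
  refine Summable.of_nonneg_of_le (fun _ => norm_nonneg _) (fun n => ?_) hc
  rw [hd, mul_comm]
  gcongr
  have key : ∀ (y : ℝ) (a : ℕ), 0 ≤ y → a ≤ 3 → y ^ a ≤ (1 + y) ^ s := by
    intro y a hy ha
    exact (pow_le_pow_left₀ hy (by linarith) a).trans
      (pow_le_pow_right₀ (by linarith) (ha.trans hs))
  unfold wt
  rw [mul_pow]
  exact mul_le_mul (key _ a (abs_nonneg _) ha) (key _ b (abs_nonneg _) hb) (by positivity)
    (by positivity)

lemma pde {s : ℕ} (hs : 3 ≤ s) (p : ℕ) (U w : A) (hw : IsReal w)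
    (h1 : ∀ n : ℤ × ℤ, Complex.I * n.1 * U n = w n) (m α ω r h : ℝ)
    (hh : h = ω ^ (2 * p + 1) * r ^ (2 * p))
    (h2 : ∀ n : ℤ × ℤ, U n * (((n.2 : ℝ) ^ 2 + m - ω ^ 2 * n.1 ^ 2 : ℝ)
      + Complex.I * (α * ω * n.1 * n.2 ^ 2 : ℝ)) = h * pw s w (2 * p) n)
    (u : ℝ → ℝ → ℝ) (hu : u = fun t x => r * (ev (coef s U) (ω * t) x).re) (t x : ℝ) :
    pdtt u t x - pdxx u t x - α * pdtxx u t x + m * u t x = (pdt u t x) ^ (2 * p + 1) := by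
  set c := coef s U with hc
  set ct : ℤ × ℤ → ℂ := fun n => Complex.I * n.1 * c n with hct
  set ctt : ℤ × ℤ → ℂ := fun n => Complex.I * n.1 * ct n with hctt
  set cx : ℤ × ℤ → ℂ := fun n => Complex.I * n.2 * c n with hcx
  set cxx : ℤ × ℤ → ℂ := fun n => Complex.I * n.2 * cx n with hcxx
  set cxxt : ℤ × ℤ → ℂ := fun n => Complex.I * n.1 * cxx n with hcxxt
  have S := coef_wt_summable s U
  have s0 : Summable (fun n => ‖c n‖) := summ_of_bound hs S 0 0 (by simp) (by simp) _
    (fun n => by simp [hc])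
  have s1 : Summable (fun n => ‖ct n‖) := summ_of_bound hs S 1 0 (by simp) (by simp) _
    (fun n => by simp [hct, hc])
  have s2 : Summable (fun n => ‖ctt n‖) := summ_of_bound hs S 2 0 (by simp) (by simp) _
    (fun n => by simp [hctt, hct, hc]; ring_nf; simp; ring)
  have s3 : Summable (fun n => ‖cx n‖) := summ_of_bound hs S 0 1 (by simp) (by simp) _
    (fun n => by simp [hcx, hc])
  have s4 : Summable (fun n => ‖cxx n‖) := summ_of_bound hs S 0 2 (by simp) (by simp) _
    (fun n => by simp [hcxx, hcx, hc]; ring_nf; simp; ring)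
  have s5 : Summable (fun n => ‖cxxt n‖) := summ_of_bound hs S 1 2 (by simp) (by simp) _
    (fun n => by simp [hcxxt, hcxx, hcx, hc]; ring_nf; simp; ring)
  have d1 : ∀ t x, pdt u t x = r * ω * (ev ct (ω * t) x).re := by
    intro t x
    unfold pdt; rw [hu]
    exact (re_scale r ω t (ev_dt s0 s1 (ω * t) x)).deriv
  have d2 : pdtt u t x = r * ω * ω * (ev ctt (ω * t) x).re := by
    unfold pdtt
    simp only [d1]
    exact (re_scale (r * ω) ω t (ev_dt s1 s2 (ω * t) x)).deriv
  have d3 : ∀ t x, pdxx u t x = r * (ev cxx (ω * t) x).re := by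
    intro t x
    have e : ∀ y, deriv (fun z => u t z) y = r * (ev cx (ω * t) y).re := by
      intro y; rw [hu]
      exact (re_x r y (ev_dx s0 s3 (ω * t) y)).deriv
    unfold pdxx
    simp only [e]
    exact (re_x r x (ev_dx s3 s4 (ω * t) x)).deriv
  have d4 : pdtxx u t x = r * ω * (ev cxxt (ω * t) x).re := by
    unfold pdtxx
    simp only [d3]
    exact (re_scale r ω t (ev_dt s4 s5 (ω * t) x)).deriv
  have hctw : ct = coef s w := by
    ext n; simp only [hct, hc, coef]; rw [← h1]; ring
  rw [d1, d2, d3, d4, hctw]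
  have him : (ev (coef s w) (ω * t) x).im = 0 := by
    apply ev_im
    intro n; simp only [coef]; rw [hw, wt_neg, map_div₀, Complex.conj_ofReal]
  have hre : ev (coef s w) (ω * t) x = ((ev (coef s w) (ω * t) x).re : ℂ) := by
    apply Complex.ext <;> simp [him]
  have hpw := ev_pw s w (2 * p) (ω * t) x
  have hlin : ((ω ^ 2 : ℝ) : ℂ) * ev ctt (ω * t) x + (-1) * ev cxx (ω * t) x
      + ((-(α * ω) : ℝ) : ℂ) * ev cxxt (ω * t) x + (m : ℂ) * ev c (ω * t) x
      = (h : ℂ) * ev (coef s (pw s w (2 * p))) (ω * t) x := by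
    rw [← ev_smul, ← ev_smul, ← ev_smul, ← ev_smul, ← ev_smul]
    have q1 : ∀ (z : ℂ) {d : ℤ × ℤ → ℂ}, Summable (fun n => ‖d n‖) →
        Summable (fun n => ‖z * d n‖) := by
      intro z d hd; simpa using hd.mul_left ‖z‖
    have q2 : ∀ {d e : ℤ × ℤ → ℂ}, Summable (fun n => ‖d n‖) → Summable (fun n => ‖e n‖) →
        Summable (fun n => ‖d n + e n‖) := fun hd he =>
      Summable.of_nonneg_of_le (fun _ => norm_nonneg _) (fun n => norm_add_le _ _) (hd.add he)
    rw [← ev_add (q1 _ s2) (q1 _ s4), ← ev_add (q2 (q1 _ s2) (q1 _ s4)) (q1 _ s5),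
      ← ev_add (q2 (q2 (q1 _ s2) (q1 _ s4)) (q1 _ s5)) (q1 _ s0)]
    congr 1; ext n
    simp only [hctt, hcxx, hcxxt, hct, hcx, hc, coef]
    have := h2 n
    rw [← mul_div_assoc (h : ℂ), ← this]
    push_cast
    field_simp
    ring_nf
    rw [show Complex.I ^ 3 = - Complex.I by rw [pow_succ, Complex.I_sq]; ring, Complex.I_sq]
    ring
  rw [hpw] at hlin
  set W := (ev (coef s w) (ω * t) x).re with hW
  rw [hre, ← Complex.ofReal_pow, ← Complex.ofReal_mul] at hlin
  have h5 := congrArg Complex.re hlin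
  simp only [Complex.add_re, Complex.re_ofReal_mul, Complex.ofReal_re] at h5
  rw [show ((-1 : ℂ)) = ((-1 : ℝ) : ℂ) by simp, Complex.re_ofReal_mul] at h5
  have : u t x = r * (ev c (ω * t) x).re := by rw [hu]
  rw [this]
  have h6 : (r * ω * W) ^ (2 * p + 1) = r * (h * W ^ (2 * p + 1)) := by
    rw [hh]; ring
  rw [h6, ← h5]; ring

noncomputable def Uf (h m : ℝ) (N g : A) (n : ℤ × ℤ) : ℂ :=
  if n.1 = 0 then (h / ((n.2 : ℝ) ^ 2 + m) : ℝ) * N n else g n / (Complex.I * n.1)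

lemma Uf_norm {h m : ℝ} (hh : 0 ≤ h) (hm : 0 < m) (N g : A) (n : ℤ × ℤ) :
    ‖Uf h m N g n‖ ≤ h / m * ‖N n‖ + ‖g n‖ := by
  unfold Uf
  split_ifs with h0
  · rw [norm_mul, Complex.norm_real, Real.norm_of_nonneg (by positivity)]
    have : h / ((n.2 : ℝ) ^ 2 + m) ≤ h / m := by
      gcongr; nlinarith [sq_nonneg (n.2 : ℝ)]
    have := mul_le_mul_of_nonneg_right this (norm_nonneg (N n))
    linarith [norm_nonneg (g n)]
  · have : 1 ≤ ‖Complex.I * (n.1 : ℂ)‖ := by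
      rw [norm_mul, Complex.norm_I, one_mul, Complex.norm_intCast]
      exact_mod_cast Int.one_le_abs h0
    rw [norm_div]
    have := div_le_self (norm_nonneg (g n)) this
    have : 0 ≤ h / m * ‖N n‖ := by positivity
    linarith

lemma Uf_summable {h m : ℝ} (hh : 0 ≤ h) (hm : 0 < m) (N g : A) :
    Summable (fun n => ‖Uf h m N g n‖) :=
  Summable.of_nonneg_of_le (fun _ => norm_nonneg _) (Uf_norm hh hm N g)
    (((A_summable N).mul_left _).add (A_summable g))

noncomputable def UU {h m : ℝ} (hh : 0 ≤ h) (hm : 0 < m) (N g : A) : A :=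
  mk (Uf h m N g) (Uf_summable hh hm N g)

lemma UU_norm {h m : ℝ} (hh : 0 ≤ h) (hm : 0 < m) (N g : A) :
    ‖UU hh hm N g‖ ≤ h / m * ‖N‖ + ‖g‖ := by
  have := A_norm_le (UU hh hm N g) _ (((A_summable N).mul_left (h / m)).add (A_summable g))
    (Uf_norm hh hm N g)
  rw [((A_summable N).mul_left (h / m)).tsum_add (A_summable g), tsum_mul_left] at this
  rwa [A_norm N, A_norm g]

lemma UU_add {h m : ℝ} (hh : 0 ≤ h) (hm : 0 < m) (N g g' : A) :
    UU hh hm N (g + g') = UU hh hm 0 g + UU hh hm N g' := by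
  apply A_ext; intro n
  rw [add_apply]
  change Uf _ _ _ _ _ = Uf _ _ _ _ _ + Uf _ _ _ _ _
  unfold Uf
  split_ifs
  · simp
  · rw [add_apply]; ring

lemma ev_UE {h m : ℝ} (hh : 0 ≤ h) (hm : 0 < m) (s : ℕ) (t x : ℝ) :
    (ev (coef s (UU hh hm 0 (E s))) t x).re = Real.cos t * Real.sin x := by
  have hval : ∀ n, coef s (UU hh hm 0 (E s)) n = if Ker n then ((n.2 / 4 : ℝ) : ℂ) * (-Complex.I) else 0 := by
    intro n
    have hw : (wt s n : ℂ) ≠ 0 := by exact_mod_cast (wt_pos s n).ne'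
    unfold coef
    change Uf _ _ _ _ _ / _ = _
    unfold Uf
    by_cases hk : Ker n
    · have h1 : n.1 ≠ 0 := by intro h0; have := hk.1; simp [h0] at this
      have h1' : (n.1 : ℂ) ≠ 0 := by exact_mod_cast h1
      rw [if_neg h1, if_pos hk, E_apply, if_pos hk]
      have := Complex.I_ne_zero
      push_cast
      field_simp
      rw [Complex.I_sq]; ring
    · rw [if_neg hk, E_apply, if_neg hk]; simp
  unfold ev
  rw [tsum_eq_sum (s := {(1,1), (1,-1), (-1,1), (-1,-1)}) (by
    intro n hn
    have : ¬ Ker n := by rw [ker_iff]; simpa using hn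
    rw [hval, if_neg this, zero_mul])]
  have hre : ∀ n, Ker n → (coef s (UU hh hm 0 (E s)) n * ee n t x).re
      = n.2 / 4 * Real.sin (n.1 * t + n.2 * x) := by
    intro n hn
    rw [hval, if_pos hn, mul_assoc, Complex.re_ofReal_mul]
    unfold ee
    rw [mul_comm Complex.I, Complex.exp_mul_I, ← Complex.ofReal_cos, ← Complex.ofReal_sin]
    simp [-Complex.ofReal_sin, -Complex.ofReal_cos]
  rw [Finset.sum_insert (by decide), Finset.sum_insert (by decide), Finset.sum_insert (by decide),
    Finset.sum_singleton, Complex.add_re, Complex.add_re, Complex.add_re, hre _ (by simp [Ker]),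
    hre _ (by simp [Ker]), hre _ (by simp [Ker]), hre _ (by simp [Ker])]
  simp only [Int.cast_one, Int.cast_neg, one_mul, neg_mul, Real.sin_add, Real.cos_neg, Real.sin_neg]
  ring

end SDB

namespace SDB
lemma theta {p : ℕ} (hp : 1 ≤ p) {y δ : ℝ} (hy : 0 < y) (hδ : |y - 1| ≤ δ) (hδ1 : δ ≤ 1) :
    ∃ θ : ℝ, 0 < θ ∧ θ ^ (2 * p) = y ^ (2 * p + 1) ∧ |θ - 1| ≤ (2 * p + 1) * 2 ^ (2 * p) * δ := by
  have h0 : 2 * p ≠ 0 := by omega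
  refine ⟨(y ^ (2 * p + 1)) ^ (((2 * p : ℕ) : ℝ)⁻¹), by positivity,
    Real.rpow_inv_natCast_pow (by positivity) h0, ?_⟩
  set θ := (y ^ (2 * p + 1)) ^ (((2 * p : ℕ) : ℝ)⁻¹) with hθ
  have hθ0 : 0 < θ := by positivity
  have hpow : θ ^ (2 * p) = y ^ (2 * p + 1) := Real.rpow_inv_natCast_pow (by positivity) h0
  have hA : |θ - 1| ≤ |θ ^ (2 * p) - 1| := by
    rcases le_total 1 θ with h | h
    · have := le_self_pow₀ h h0
      rw [abs_of_nonneg (by linarith), abs_of_nonneg (by linarith)]; linarith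
    · have := pow_le_of_le_one hθ0.le h h0
      rw [abs_of_nonpos (by linarith), abs_of_nonpos (by linarith)]; linarith
  have hB := abs_pow_sub_pow_le y 1 (2 * p + 1)
  have hy2 : max |y| |(1:ℝ)| ≤ 2 := by
    have := abs_le.1 hδ
    rw [abs_of_pos hy, abs_one]; exact max_le (by linarith) (by norm_num)
  rw [hpow] at hA
  refine hA.trans ?_
  rw [one_pow] at hB
  refine hB.trans ?_
  have : (max |y| |(1:ℝ)|) ^ (2 * p + 1 - 1) ≤ 2 ^ (2 * p) := by
    rw [Nat.add_sub_cancel]; exact pow_le_pow_left₀ (by positivity) hy2 _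
  push_cast
  calc |y - 1| * (2 * p + 1) * (max |y| |(1:ℝ)|) ^ (2 * p + 1 - 1)
      ≤ δ * (2 * p + 1) * 2 ^ (2 * p) := by
        have := (abs_nonneg _).trans hδ
        gcongr
    _ = _ := by ring

lemma sol {m : ℝ} (hm : 0 < m) {s : ℕ} (hs : 3 ≤ s) {p : ℕ} {h : ℝ} (hh : 0 < h) {q : A}
    (hr : IsReal q) (ho : IsOdd q) {z : ℂ}
    (hq : ∀ n, (E s+q) n * ((D m n - h*z.im*n.1^2:ℝ) + Complex.I*(h*z.re*n.1*n.2^2:ℝ)) = Complex.I*(h*n.1:ℝ)*pw s (E s+q) (2*p) n)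
    {ω r α : ℝ} (hω : 0 < ω) (hω2 : ω ^ 2 = 1 + m + h * z.im) (hα : α * ω = h * z.re)
    (hhr : h = ω ^ (2 * p + 1) * r ^ (2 * p)) (u : ℝ → ℝ → ℝ) 
    (hu : u = fun t x => r * (ev (coef s (UU hh.le hm (pw s (E s + q) (2 * p)) (E s + q))) (ω * t) x).re) :
    ContDiff ℝ s (fun q : ℝ × ℝ => u q.1 q.2) ∧
          (∀ t x : ℝ,
            pdtt u t x - pdxx u t x - α * pdtxx u t x + m * u t x
              = (pdt u t x)^(2*p+1)) ∧
          (∀ t : ℝ, u t 0 = 0 ∧ u t Real.pi = 0) ∧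
          (∀ t x : ℝ, u (t + 2*Real.pi/ω) x = u t x) := by
  have hwr : IsReal (E s + q) := by
    intro n; simp only [add_apply, map_add]; rw [hr n, E_real s n]
  have hwo : IsOdd (E s + q) := by
    intro n; simp only [add_apply]; rw [ho n, E_odd s n]; ring
  set w := E s + q with hw
  have hNo := pw_odd s hwo p
  set N := pw s w (2 * p) with hN
  set U := UU hh.le hm N w with hU
  have hUv : ∀ n, U n = if n.1 = 0 then ((h / ((n.2:ℝ)^2 + m) : ℝ) : ℂ) * N n else w n / (Complex.I * n.1) := fun n => rfl
  have hw0 : ∀ n : ℤ × ℤ, n.1 = 0 → w n = 0 := by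
    intro n hn
    have := hq n
    rw [hn] at this
    simp only [Int.cast_zero, mul_zero, Complex.ofReal_zero, zero_mul, add_zero, D, hn] at this
    rcases mul_eq_zero.1 this with h | h
    · exact h
    · exfalso
      have : (n.2:ℝ)^2 + m > 0 := by positivity
      norm_cast at h
      simp at h
      push_cast at h
      linarith
  have hU1 : ∀ n : ℤ × ℤ, Complex.I * n.1 * U n = w n := by
    intro n; rw [hUv]
    split_ifs with h
    · simp [h, hw0 n h]
    · have : (n.1 : ℂ) ≠ 0 := by exact_mod_cast h
      have := Complex.I_ne_zero
      field_simp
  have hU2 : ∀ n : ℤ × ℤ, U n*(((n.2:ℝ)^2+m-ω^2*n.1^2:ℝ)+Complex.I*(α*ω*n.1*n.2^2:ℝ)) = h*N n := by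
    intro n
    rw [hω2, hα]
    by_cases h0 : n.1 = 0
    · rw [hUv, if_pos h0, h0]
      have h3 : ((n.2:ℝ)^2 + m) ≠ 0 := by positivity
      have h4 : ((n.2:ℂ)^2 + m) ≠ 0 := by exact_mod_cast h3
      push_cast
      field_simp
      ring
    · have h1 : (n.1 : ℂ) ≠ 0 := by exact_mod_cast h0
      have h2 := Complex.I_ne_zero
      apply mul_left_cancel₀ (mul_ne_zero h2 h1)
      rw [← mul_assoc, hU1]
      have := hq n
      simp only [D] at this
      push_cast at this ⊢
      linear_combination this
  have hUo : ∀ n, coef s U (rf n) = - coef s U n := by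
    intro n
    unfold coef
    rw [wt_rf, hUv, hUv, hNo n, hwo n]
    by_cases h0 : n.1 = 0
    · simp only [rf, h0, if_true]; push_cast; ring
    · simp only [rf, h0, if_false]; push_cast; ring
  refine ⟨?_, fun t x => pde hs p U w hwr hU1 m α ω r h hhr hU2 u hu t x, ?_, ?_⟩
  · rw [hu]
    have h1 := ev_contDiff s (coef_wt_summable s U)
    have h2 : ContDiff ℝ s (fun q : ℝ × ℝ => (ω * q.1, q.2)) := by fun_prop
    exact contDiff_const.mul (Complex.reCLM.contDiff.comp (h1.comp h2))
  · intro t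
    rw [hu]
    constructor
    · simp only; rw [ev_x0 hUo _ _ (Or.inl rfl)]; simp
    · simp only; rw [ev_x0 hUo _ _ (Or.inr rfl)]; simp
  · intro t x
    rw [hu]
    simp only
    have : ω * (t + 2 * Real.pi / ω) = ω * t + 2 * Real.pi := by field_simp
    rw [this, ev_per]

lemma vbound {m : ℝ} (hm : 0 < m) (s : ℕ) {h : ℝ} (hh : 0 < h) (N q : A) (ρ r K : ℝ) (hr : 0 ≤ r)
   (hK : 0 ≤ K) (hN : ‖N‖ ≤ K) (hq : ‖q‖ ≤ K * h) (t x : ℝ) :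
   |r * (ev (coef s (UU hh.le hm N (E s + q))) t x).re - ρ * Real.cos t * Real.sin x|
    ≤ |r - ρ| + r * (h / m * K + K * h) := by
  have e : ev (coef s (UU hh.le hm N (E s + q))) t x = ev (coef s (UU hh.le hm 0 (E s))) t x
     + ev (coef s (UU hh.le hm N q)) t x := by
    rw [UU_add, ← ev_add (coef_summable _ _) (coef_summable _ _)]
    congr 1; ext n; unfold coef; rw [add_apply]; ring
  rw [e, Complex.add_re, ev_UE]
  have h1 : |(ev (coef s (UU hh.le hm N q)) t x).re| ≤ h / m * K + K * h := by
    refine (Complex.abs_re_le_norm _).trans ((ev_norm (coef_summable _ _) t x).trans ?_)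
    refine ((coef_summable _ _).tsum_le_tsum (coef_norm_le s _) (A_summable _)).trans ?_
    rw [← A_norm]
    refine (UU_norm hh.le hm N q).trans ?_
    gcongr
  have h2 : |Real.cos t * Real.sin x| ≤ 1 := by
    rw [abs_mul]; exact mul_le_one₀ (Real.abs_cos_le_one _) (abs_nonneg _) (Real.abs_sin_le_one _)
  calc _ = |(r - ρ) * (Real.cos t * Real.sin x) + r * (ev (coef s (UU hh.le hm N q)) t x).re| := by
        congr 1; ring
    _ ≤ |r - ρ| * |Real.cos t * Real.sin x| + r * |(ev (coef s (UU hh.le hm N q)) t x).re| := by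
        refine (abs_add_le _ _).trans ?_
        rw [abs_mul, abs_mul r, abs_of_nonneg hr]
    _ ≤ |r - ρ| * 1 + r * (h / m * K + K * h) := by gcongr
    _ = _ := by ring
end SDB

set_option maxHeartbeats 1600000 in
theorem small_damping_bifurcation
    (p : ℕ) (hp : 1 ≤ p) (m : ℝ) (hm : 0 < m) (hmi : Irrational m)
    (k0 : ℕ) (hk0 : 3 ≤ k0) :
    ∃ M > (0:ℝ), ∃ c > (0:ℝ), ∃ C > (0:ℝ), ∀ ρ : ℝ, 0 < ρ → ρ < M →
      ∃ α ω : ℝ,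
        c * ρ ^ (2*p) ≤ α ∧
        |ω^2 - (1+m)| ≤ C * ρ^(2*p+1) ∧
        ∃ u : ℝ → ℝ → ℝ,
          ContDiff ℝ k0 (fun q : ℝ × ℝ => u q.1 q.2) ∧
          (∀ t x : ℝ,
            pdtt u t x - pdxx u t x - α * pdtxx u t x + m * u t x
              = (pdt u t x)^(2*p+1)) ∧
          (∀ t : ℝ, u t 0 = 0 ∧ u t Real.pi = 0) ∧
          (∀ t x : ℝ, u (t + 2*Real.pi/ω) x = u t x) ∧
          ∃ v : ℝ → ℝ → ℝ,
            (∀ t x : ℝ, v (t + 2*Real.pi) x = v t x) ∧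
            (∀ t x : ℝ, u t x = ρ * Real.cos (ω*t) * Real.sin x + v (ω*t) x) ∧
            (∀ t x : ℝ, |v t x| ≤ C * ρ ^ (2*(p:ℝ) + 1/2)) := by
  obtain ⟨K, hK, h0, hh0, a0, ha0, hcore⟩ := SDB.core hm hmi k0 p
  set ω0 := Real.sqrt (1 + m) with hω0
  have hω0p : 0 < ω0 := Real.sqrt_pos.2 (by linarith)
  have hω0s : ω0 ^ 2 = 1 + m := Real.sq_sqrt (by linarith)
  set H := ω0 ^ (2 * p + 1) with hH
  have hHp : 0 < H := by positivity
  set T : ℝ := (2 * p + 1) * 2 ^ (2 * p) with hT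
  have hTp : 0 < T := by positivity
  set μ := min h0 (min (a0 / (2 * K)) (min 1 (min (m / K) (1 / K)))) with hμ
  have hμp : 0 < μ := by positivity
  refine ⟨min 1 (μ / H), by positivity, H * a0 / (2 * (1 + m)), by positivity,
    K * H ^ 2 + T * K * H ^ 2 + (1 + T) * (K / m + K) * H, by positivity, ?_⟩
  intro ρ hρ hρM
  have hρ1 : ρ < 1 := hρM.trans_le (min_le_left _ _)
  have hρ2 : ρ < μ / H := hρM.trans_le (min_le_right _ _)
  have hHρ : H * ρ < μ := by rw [lt_div_iff₀ hHp] at hρ2; linarith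
  set h := H * ρ ^ (2 * p) with hhdef
  have hh : 0 < h := by positivity
  have hhμ : h < μ := by
    have : ρ ^ (2 * p) ≤ ρ := pow_le_of_le_one hρ.le hρ1.le (by omega)
    have := mul_le_mul_of_nonneg_left this hHp.le
    linarith
  simp only [hμ, lt_min_iff] at hhμ
  obtain ⟨b1, b2, b3, b4, b5⟩ := hhμ
  have hKh1 : K * h ≤ a0 / 2 := by
    rw [lt_div_iff₀ (by positivity)] at b2; linarith
  have hKh2 : K * h ≤ m := by rw [lt_div_iff₀ hK] at b4; linarith
  have hKh3 : K * h ≤ 1 := by rw [lt_div_iff₀ hK] at b5; linarith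
  obtain ⟨q, hq, hqr, hqo, -, hN, z, hz1, hz2, heq⟩ := hcore h hh b1
  have hhb : |h * z.im| ≤ K * h ^ 2 := by
    rw [abs_mul, abs_of_pos hh]
    calc h * |z.im| ≤ h * (K * h) := by gcongr
      _ = _ := by ring
  have hKhh : K * h ^ 2 ≤ K * h := by
    rw [pow_two]
    have : h * h ≤ h * 1 := by gcongr
    nlinarith
  have hb' := abs_le.1 hhb
  have ha : a0 / 2 ≤ z.re := by have := abs_le.1 hz1; linarith
  set ω := Real.sqrt (1 + m + h * z.im) with hωd
  have hωs : ω ^ 2 = 1 + m + h * z.im := Real.sq_sqrt (by linarith)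
  have hω1 : 1 ≤ ω := by rw [hωd, Real.one_le_sqrt]; linarith
  have hω : 0 < ω := by linarith
  have hωm : ω ≤ 1 + m := by
    rw [hωd, Real.sqrt_le_left (by linarith)]; nlinarith
  have hy : 0 < ω0 / ω := by positivity
  have hδ : |ω0 / ω - 1| ≤ K * h ^ 2 := by
    have e1 : (ω0 / ω - 1) * ((ω0 / ω + 1) * ω ^ 2) = - (h * z.im) := by
      have : (ω0 / ω - 1) * ((ω0 / ω + 1) * ω ^ 2) = ω0 ^ 2 - ω ^ 2 := by field_simp; ring
      rw [this, hω0s, hωs]; ring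
    have e2 : |ω0 / ω - 1| * ((ω0 / ω + 1) * ω ^ 2) = |h * z.im| := by
      rw [← abs_neg (h * z.im), ← e1, abs_mul, abs_of_pos (show 0 < (ω0 / ω + 1) * ω ^ 2 by positivity)]
    have e3 : 1 ≤ (ω0 / ω + 1) * ω ^ 2 := by
      have : 1 ≤ ω ^ 2 := one_le_pow₀ hω1
      exact one_le_mul_of_one_le_of_one_le (by linarith) this
    have := le_mul_of_one_le_right (abs_nonneg (ω0 / ω - 1)) e3
    linarith
  obtain ⟨θ, hθ, hθp, hθ1⟩ := SDB.theta hp hy hδ (by linarith)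
  have hhr : h = ω ^ (2 * p + 1) * (ρ * θ) ^ (2 * p) := by
    rw [mul_pow, hθp, div_pow, hhdef, hH]; field_simp
  have hsq : h ^ 2 ≤ H ^ 2 * ρ ^ (2 * p + 1) := by
    rw [hhdef, mul_pow]
    gcongr ?_ * ?_
    rw [← pow_mul]; exact pow_le_pow_of_le_one hρ.le hρ1.le (by omega)
  have hρpow : 0 < ρ ^ (2 * p + 1) := by positivity
  have hC1 : 0 < T * K * H ^ 2 + (1 + T) * (K / m + K) * H := by positivity
  have hC2 : 0 < K * H ^ 2 := by positivity
  refine ⟨h * z.re / ω, ω, ?_, ?_, ?_⟩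
  · rw [le_div_iff₀ hω]
    calc H * a0 / (2 * (1 + m)) * ρ ^ (2 * p) * ω
        ≤ H * a0 / (2 * (1 + m)) * ρ ^ (2 * p) * (1 + m) := by gcongr
      _ = h * (a0 / 2) := by rw [hhdef]; field_simp
      _ ≤ _ := by gcongr
  · rw [hωs, add_sub_cancel_left]
    calc _ ≤ K * h ^ 2 := hhb
      _ ≤ K * (H ^ 2 * ρ ^ (2 * p + 1)) := by gcongr
      _ = K * H ^ 2 * ρ ^ (2 * p + 1) := by ring
      _ ≤ _ := by gcongr; linarith
  · obtain ⟨s1, s2, s3, s4⟩ := SDB.sol hm hk0 hh hqr hqo heq hω hωs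
      (div_mul_cancel₀ _ hω.ne') hhr _ rfl
    refine ⟨_, s1, s2, s3, s4, fun t x => ρ * θ * (SDB.ev (SDB.coef k0 (SDB.UU hh.le hm
      (SDB.pw k0 (SDB.E k0 + q) (2 * p)) (SDB.E k0 + q))) t x).re
        - ρ * Real.cos t * Real.sin x, ?_, ?_, ?_⟩
    · intro t x
      simp only
      rw [SDB.ev_per, Real.cos_add_two_pi]
    · intro t x; ring
    · intro t x
      refine (SDB.vbound hm k0 hh _ q ρ (ρ * θ) K (by positivity) hK.le hN hq t x).trans ?_
      have e1 : |ρ * θ - ρ| ≤ T * K * H ^ 2 * ρ ^ (2 * p + 1) := by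
        have : ρ * θ - ρ = ρ * (θ - 1) := by ring
        rw [this, abs_mul, abs_of_pos hρ]
        calc ρ * |θ - 1| ≤ 1 * (T * (K * h ^ 2)) := by gcongr
          _ ≤ 1 * (T * (K * (H ^ 2 * ρ ^ (2 * p + 1)))) := by gcongr
          _ = _ := by ring
      have e2 : θ ≤ 1 + T := by
        have := (abs_le.1 hθ1).2
        have : T * (K * h ^ 2) ≤ T * 1 := by gcongr; linarith
        linarith
      have e3 : ρ * θ * (h / m * K + K * h) ≤ (1 + T) * (K / m + K) * H * ρ ^ (2 * p + 1) := by
        calc ρ * θ * (h / m * K + K * h) ≤ ρ * (1 + T) * (h / m * K + K * h) := by gcongr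
          _ = _ := by rw [hhdef]; ring
      have e4 : ρ ^ (2 * p + 1) ≤ ρ ^ (2 * (p : ℝ) + 1 / 2) := by
        rw [← Real.rpow_natCast]
        apply Real.rpow_le_rpow_of_exponent_ge hρ hρ1.le
        push_cast; linarith
      calc _ ≤ T * K * H ^ 2 * ρ ^ (2 * p + 1) + (1 + T) * (K / m + K) * H * ρ ^ (2 * p + 1) :=
            add_le_add e1 e3
        _ ≤ (K * H ^ 2 + T * K * H ^ 2 + (1 + T) * (K / m + K) * H) * ρ ^ (2 * p + 1) := by
            rw [← add_mul]; gcongr; linarith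
        _ ≤ _ := by gcongr
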